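/- arXiv:2010.05130 — 4 statements merged into one kernel-verified Lean document; each statement's English description precedes it below -/
import Mathlib

section
/- Fix a real parameter α ≥ 2. Let Γ(t) be a solution of Hill's lunar equations with E(Γ(0)) = E*, K(Γ(0)) < 0 and W(Γ(0)) ≤ 0, with maximal time of existence T_max. Then either T_max < ∞ and the solution collides with the origin ((x(t),y(t)) → (0,0) as t → T_max), or T_max = ∞ and Γ(t) converges as t → ∞ to one of the ground states ±Q = (±α^{1/(α+2)}, 0, 0, 0) (in particular K(Γ(t)) → 0). -/
open Real Set Filter Topology ENNReal

/-- r = √(x² + y²), the distance to the origin in the configuration plane. -/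
noncomputable def hillR (x y : ℝ) : ℝ := Real.sqrt (x ^ 2 + y ^ 2)

/-- The effective potential V(x,y) = −((α+2)/2)x² − (α+2)/r^α. -/
noncomputable def hillV (α x y : ℝ) : ℝ :=
  -((α + 2) / 2) * x ^ 2 - (α + 2) / (hillR x y) ^ α

/-- The partial derivative V_x. -/
noncomputable def hillVx (α x y : ℝ) : ℝ :=
  -(α + 2) * x + (α + 2) * α * x / (hillR x y) ^ (α + 2)

/-- The partial derivative V_y. -/
noncomputable def hillVy (α x y : ℝ) : ℝ :=
  (α + 2) * α * y / (hillR x y) ^ (α + 2)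

/-- The energy E(Γ) = ½(ẋ² + ẏ²) + V(x,y). -/
noncomputable def hillE (α x y vx vy : ℝ) : ℝ :=
  (1 / 2) * (vx ^ 2 + vy ^ 2) + hillV α x y

/-- W(Γ) = −xV_x − yV_y = (α+2)(x² − α/r^α). -/
noncomputable def hillW (α x y : ℝ) : ℝ :=
  (α + 2) * (x ^ 2 - α / (hillR x y) ^ α)

/-- K(Γ) = ẋ² + ẏ² + 2(xẏ − ẋy) + W(Γ). -/
noncomputable def hillK (α x y vx vy : ℝ) : ℝ :=
  vx ^ 2 + vy ^ 2 + 2 * (x * vy - vx * y) + hillW α x y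

/-- The ground state energy E* = −½(α+2)²α^{−α/(α+2)}. -/
noncomputable def hillEstar (α : ℝ) : ℝ :=
  -(1 / 2) * (α + 2) ^ 2 * α ^ (-(α / (α + 2)))

/-- The time interval [0, Tmax), where Tmax ∈ (0, ∞]. -/
def hillDomain (Tmax : ℝ≥0∞) : Set ℝ := {t : ℝ | 0 ≤ t ∧ ENNReal.ofReal t < Tmax}

/-- `HillSolOn α x y Tmax` : (x(t), y(t)) is a solution of Hill's lunar equations
ẍ − 2ẏ = −V_x, ÿ + 2ẋ = −V_y avoiding the origin on the interval [0, Tmax). -/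
def HillSolOn (α : ℝ) (x y : ℝ → ℝ) (Tmax : ℝ≥0∞) : Prop :=
  ∀ t ∈ hillDomain Tmax,
    (x t, y t) ≠ (0, 0) ∧
    HasDerivAt x (deriv x t) t ∧ HasDerivAt y (deriv y t) t ∧
    HasDerivAt (deriv x) (2 * deriv y t - hillVx α (x t) (y t)) t ∧
    HasDerivAt (deriv y) (-(2 * deriv x t) - hillVy α (x t) (y t)) t

/-- `HillMaxSol α x y Tmax` : (x(t), y(t)) is a solution of Hill's lunar equations on its
maximal interval of existence [0, Tmax): no solution on a strictly larger interval extends it. -/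
def HillMaxSol (α : ℝ) (x y : ℝ → ℝ) (Tmax : ℝ≥0∞) : Prop :=
  HillSolOn α x y Tmax ∧
  ∀ T' : ℝ≥0∞, Tmax < T' →
    ¬∃ x₂ y₂ : ℝ → ℝ, HillSolOn α x₂ y₂ T' ∧
      ∀ t ∈ hillDomain Tmax, x₂ t = x t ∧ y₂ t = y t


abbrev HillSt := ℝ × ℝ × ℝ × ℝ

lemma hill_local_flow {E : Type*} [NormedAddCommGroup E] [NormedSpace ℝ E] [CompleteSpace E]
    {F : E → E} {U : Set E} (hU : IsOpen U) {p : E} (hp : p ∈ U) (hF : ContDiffAt ℝ 1 F p) :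
    ∃ ρ > (0:ℝ), ∃ ε > (0:ℝ), ∀ z0 ∈ Metric.ball p ρ, ∃ z : ℝ → E, z 0 = z0 ∧
      ∀ t ∈ Ioo (-ε) ε, HasDerivAt z (F (z t)) t ∧ z t ∈ U := by
  obtain ⟨ε, hε, a, r, L, K, hr, hpl⟩ := IsPicardLindelof.of_contDiffAt_one hF
  obtain ⟨φ, h1, h2⟩ := (hpl 0).exists_forall_mem_closedBall_eq_hasDerivWithinAt_continuousOn
  have hr' : (0:ℝ) < r := by exact_mod_cast hr
  have hnhds : Metric.closedBall p (r:ℝ) ×ˢ Icc (0 - ε) (0 + ε) ∈ 𝓝 (p, (0:ℝ)) :=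
    prod_mem_nhds (Metric.closedBall_mem_nhds _ hr') (Icc_mem_nhds (by linarith) (by linarith))
  have hc : ContinuousAt φ (p, (0:ℝ)) := h2.continuousAt hnhds
  have hp0 : φ (p, (0:ℝ)) = p := (h1 p (Metric.mem_closedBall_self hr'.le)).1
  have hev : ∀ᶠ q in 𝓝 (p, (0:ℝ)), φ q ∈ U ∧ q ∈ Metric.closedBall p (r:ℝ) ×ˢ Icc (0 - ε) (0 + ε) := by
    refine Filter.Eventually.and ?_ hnhds
    exact hc (hU.mem_nhds (by rw [hp0]; exact hp))
  rw [Metric.eventually_nhds_iff_ball] at hev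
  obtain ⟨δ, hδ, hb⟩ := hev
  refine ⟨δ, hδ, min δ ε, lt_min hδ hε, fun z0 hz0 => ⟨fun t => φ (z0, t), ?_, fun t ht => ?_⟩⟩
  · have := hb (z0, 0) (by rw [← ball_prod_same]; exact ⟨hz0, Metric.mem_ball_self hδ⟩)
    exact (h1 z0 this.2.1).1
  · have ht1 : |t| < min δ ε := abs_lt.2 ht
    have ht2 := lt_min_iff.1 ht1
    have := hb (z0, t) (by
      rw [← ball_prod_same]; exact ⟨hz0, by simpa [Real.dist_eq] using ht2.1⟩)
    refine ⟨?_, this.1⟩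
    have ht3 := abs_lt.1 ht2.2
    exact ((h1 z0 this.2.1).2 t this.2.2).hasDerivAt (Icc_mem_nhds (by linarith) (by linarith))

lemma hill_ode_unique {E : Type*} [NormedAddCommGroup E] [NormedSpace ℝ E]
    {F : E → E} {U : Set E} (hF : ∀ p ∈ U, ContDiffAt ℝ 1 F p) {a b t0 : ℝ}
    (ht0 : t0 ∈ Ioo a b) {f g : ℝ → E}
    (hf : ∀ t ∈ Ioo a b, HasDerivAt f (F (f t)) t ∧ f t ∈ U)
    (hg : ∀ t ∈ Ioo a b, HasDerivAt g (F (g t)) t ∧ g t ∈ U)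
    (h0 : f t0 = g t0) : EqOn f g (Ioo a b) := by
  have key : ∀ t ∈ Ioo a b, f t = g t → f =ᶠ[𝓝 t] g := by
    intro t ht he
    obtain ⟨K, s, hs, hl⟩ := (hF (f t) (hf t ht).2).exists_lipschitzOnWith
    have hI : Ioo a b ∈ 𝓝 t := isOpen_Ioo.mem_nhds ht
    refine ODE_solution_unique_of_eventually (v := fun _ => F) (s := fun _ => s) (K := K)
      (Filter.Eventually.of_forall fun _ => hl) ?_ ?_ he
    · have := (hf t ht).1.continuousAt.eventually_mem hs
      filter_upwards [this, hI] with u hu1 hu2 using ⟨(hf u hu2).1, hu1⟩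
    · have := (hg t ht).1.continuousAt.eventually_mem (by rw [← he]; exact hs)
      filter_upwards [this, hI] with u hu1 hu2 using ⟨(hg u hu2).1, hu1⟩
  have hsub : Ioo a b ⊆ {t | f =ᶠ[𝓝 t] g} := by
    refine isPreconnected_Ioo.subset_of_closure_inter_subset ?_ ⟨t0, ht0, key t0 ht0 h0⟩ ?_
    · exact isOpen_setOfPred_eventually_nhds
    · rintro t ⟨hc, ht⟩
      refine key t ht ?_
      have hfr : ∃ᶠ u in 𝓝 t, f u = g u := by
        rw [mem_closure_iff_frequently] at hc
        exact hc.mono fun u hu => hu.self_of_nhds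
      by_contra hne
      have h2 : ∀ᶠ u in 𝓝 t, f u ≠ g u := by
        have h3 : ContinuousAt (fun u => f u - g u) t :=
          (hf t ht).1.continuousAt.sub (hg t ht).1.continuousAt
        filter_upwards [h3.eventually_ne (sub_ne_zero.2 hne)] with u hu using sub_ne_zero.1 hu
      exact hfr h2
  exact fun t ht => (hsub ht).self_of_nhds

/-- q² and friends. -/
lemma hill_q_facts {α : ℝ} (hα : 2 ≤ α) :
    ∃ q Q : ℝ, q = α ^ ((1 : ℝ) / (α + 2)) ∧ 0 < q ∧ 0 < Q ∧ Q = q ^ α ∧ q ^ 2 * Q = α ∧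
      2 * hillEstar α = - (α + 2) ^ 2 / Q := by
  have h0 : 0 < α := by linarith
  refine ⟨α ^ ((1 : ℝ) / (α + 2)), (α ^ ((1 : ℝ) / (α + 2))) ^ α, rfl, by positivity, by positivity,
    rfl, ?_, ?_⟩
  · rw [← Real.rpow_natCast, ← Real.rpow_mul h0.le, ← Real.rpow_mul h0.le, ← Real.rpow_add h0]
    have : 1 / (α + 2) * ((2:ℕ):ℝ) + 1 / (α + 2) * α = 1 := by push_cast; field_simp; ring
    rw [this, Real.rpow_one]
  · unfold hillEstar
    rw [← Real.rpow_mul h0.le, Real.rpow_neg h0.le]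
    have : 1 / (α + 2) * α = α / (α + 2) := by ring
    rw [this]
    have : 0 < α ^ (α / (α + 2)) := by positivity
    field_simp

lemma hillR_sq (x y : ℝ) : hillR x y ^ 2 = x ^ 2 + y ^ 2 := Real.sq_sqrt (by positivity)

lemma hillR_pos {x y : ℝ} (h : (x, y) ≠ (0, 0)) : 0 < hillR x y := by
  refine Real.sqrt_pos.2 ?_
  by_contra hc
  apply h
  have h1 : x ^ 2 = 0 := by nlinarith [sq_nonneg x, sq_nonneg y]
  have h2 : y ^ 2 = 0 := by nlinarith [sq_nonneg x, sq_nonneg y]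
  simp_all

lemma hill_bernoulli {α r q : ℝ} (hα : 2 ≤ α) (hr : 0 < r) (hq : 0 < q) :
    1 - (α / 2) * (1 - r ^ 2 / q ^ 2) ≤ r ^ α / q ^ α := by
  have h := one_add_mul_self_le_rpow_one_add (s := r ^ 2 / q ^ 2 - 1)
    (by have : 0 < r ^ 2 / q ^ 2 := by positivity
        linarith) (p := α / 2) (by linarith)
  have e : (1 + (r ^ 2 / q ^ 2 - 1)) ^ (α / 2) = r ^ α / q ^ α := by
    rw [show 1 + (r ^ 2 / q ^ 2 - 1) = (r / q) ^ (2:ℝ) by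
      rw [Real.rpow_two]; ring, ← Real.rpow_mul (by positivity), Real.div_rpow hr.le hq.le]
    congr 2 <;> ring
  rw [e] at h
  linarith

/-- static: r ≤ q. -/
lemma hill_r_le {α : ℝ} (hα : 2 ≤ α) {x y vx vy q : ℝ} (hq : q = α ^ ((1 : ℝ) / (α + 2)))
    (hne : (x, y) ≠ (0, 0)) (hE : hillE α x y vx vy = hillEstar α) (hW : hillW α x y ≤ 0) :
    hillR x y ≤ q := by
  obtain ⟨q', Q, hq', hqp, hQ, hQq, hS, hEs⟩ := hill_q_facts hα
  obtain rfl : q = q' := hq.trans hq'.symm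
  have hr := hillR_pos hne
  have hP : 0 < hillR x y ^ α := by positivity
  unfold hillE hillV at hE
  unfold hillW at hW
  set P := hillR x y ^ α with hPd
  have h1 : x ^ 2 - α / P ≤ 0 := by
    by_contra hc; push Not at hc
    have : 0 < (α + 2) * (x ^ 2 - α / P) := by positivity
    linarith
  have h2 : (α + 2) ^ 2 / Q ≤ (α + 2) ^ 2 / P := by
    have e1 : (α + 2) ^ 2 / P = (α + 2) * (α / P) + 2 * ((α + 2) / P) := by ring
    have e2 : (α + 2) * x ^ 2 ≤ (α + 2) * (α / P) := by
      apply mul_le_mul_of_nonneg_left <;> linarith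
    have e3 : - (α + 2) ^ 2 / Q = - ((α + 2) ^ 2 / Q) := by ring
    rw [e3] at hEs
    rw [e1]
    nlinarith [sq_nonneg vx, sq_nonneg vy]
  have h3 : P ≤ Q := by
    rw [div_le_div_iff₀ hQ hP] at h2
    have : 0 < (α + 2) ^ 2 := by positivity
    exact le_of_mul_le_mul_left h2 this
  rw [hQq] at h3
  exact (Real.rpow_le_rpow_iff hr.le hqp.le (by linarith)).1 h3

/-- static: W = 0 forces a ground state. -/
lemma hill_W_zero {α : ℝ} (hα : 2 ≤ α) {x y vx vy q : ℝ} (hq : q = α ^ ((1 : ℝ) / (α + 2)))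
    (hne : (x, y) ≠ (0, 0)) (hE : hillE α x y vx vy = hillEstar α) (hW : hillW α x y = 0) :
    (x = q ∨ x = -q) ∧ y = 0 ∧ vx = 0 ∧ vy = 0 := by
  have hle := hill_r_le hα hq hne hE hW.le
  obtain ⟨q', Q, hq', hqp, hQ, hQq, hS, hEs⟩ := hill_q_facts hα
  obtain rfl : q = q' := hq.trans hq'.symm
  have hr := hillR_pos hne
  have hP : 0 < hillR x y ^ α := by positivity
  have hR := hillR_sq x y
  unfold hillW at hW
  have h1 : x ^ 2 = α / hillR x y ^ α := by
    have : α + 2 ≠ 0 := by linarith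
    have := (mul_eq_zero.1 hW).resolve_left this
    linarith
  have hrq : hillR x y = q := by
    refine le_antisymm hle ?_
    by_contra hc; push Not at hc
    have h2 : hillR x y ^ α < Q := by
      rw [hQq]; exact Real.rpow_lt_rpow hr.le hc (by linarith)
    have h3 : x ^ 2 * hillR x y ^ α = α := by rw [h1]; field_simp
    have h4 : x ^ 2 ≤ q ^ 2 := by nlinarith [sq_nonneg y]
    nlinarith [mul_lt_mul_of_pos_left h2 (by positivity : 0 < q ^ 2)]
  rw [hrq, ← hQq] at h1
  have h5 : x ^ 2 = q ^ 2 := by rw [h1, ← hS]; field_simp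
  rw [hrq] at hR
  have hy : y ^ 2 = 0 := by linarith
  unfold hillE hillV at hE
  rw [hrq, ← hQq, h1] at hE
  have hv : vx ^ 2 + vy ^ 2 = 0 := by
    have : (1 / 2) * (vx ^ 2 + vy ^ 2) = 0 := by
      have e : hillEstar α = - (α + 2) ^ 2 / Q / 2 := by linarith
      rw [e] at hE
      have : - ((α + 2) / 2) * (α / Q) - (α + 2) / Q = - (α + 2) ^ 2 / Q / 2 := by ring
      linarith
    linarith
  refine ⟨sq_eq_sq_iff_eq_or_eq_neg.1 h5, by simpa using hy, ?_, ?_⟩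
  · have : vx ^ 2 = 0 := by nlinarith [sq_nonneg vx, sq_nonneg vy]
    simpa using this
  · have : vy ^ 2 = 0 := by nlinarith [sq_nonneg vx, sq_nonneg vy]
    simpa using this

/-- scaled inequality. -/
lemma hill_scaled {b u w : ℝ} (hb : b ≤ 1) (hu : 0 ≤ u) (hw : 0 ≤ w)
    (h : b * w ≤ u * (1 + w)) : (1 - u) * (b * w - u) ≤ (u + (1 - b) * w) ^ 2 := by
  have h1 : (1 - u) * (b * w - u) ≤ u * (u + (1 - b) * w) := by nlinarith
  have h2 : 0 ≤ (1 - b) * w := mul_nonneg (by linarith) hw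
  nlinarith

set_option maxHeartbeats 1000000 in
/-- static: K bound. -/
lemma hill_K_le {α : ℝ} (hα : 2 ≤ α) {x y vx vy q : ℝ} (hq : q = α ^ ((1 : ℝ) / (α + 2)))
    (hne : (x, y) ≠ (0, 0)) (hE : hillE α x y vx vy = hillEstar α) (hW : hillW α x y ≤ 0) :
    hillK α x y vx vy ≤ -((α + 2) * (q ^ 2 - (x ^ 2 + y ^ 2))) := by
  have hle := hill_r_le hα hq hne hE hW
  obtain ⟨q', Q, hq', hqp, hQ, hQq, hS, hEs⟩ := hill_q_facts hα
  obtain rfl : q = q' := hq.trans hq'.symm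
  have hr := hillR_pos hne
  have hP : 0 < hillR x y ^ α := by positivity
  have hR := hillR_sq x y
  have hB := hill_bernoulli hα hr hqp
  have hPQ : hillR x y ^ α ≤ Q := by
    rw [hQq]; exact Real.rpow_le_rpow hr.le hle (by linarith)
  have hRS : hillR x y ^ 2 ≤ q ^ 2 := by nlinarith
  rw [← hQq] at hB
  unfold hillK hillW
  unfold hillE hillV at hE
  rw [← hR]
  set r := hillR x y with hrd
  set P := r ^ α with hPd
  have hα0 : 0 < α := by linarith
  have hq2 : 0 < q ^ 2 := by positivity
  set f := -(α + 2) ^ 2 / Q + (α + 2) * r ^ 2 + 2 * ((α + 2) / P) with hf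
  set H := (α + 2) * (2 / Q - r ^ 2 + (α - 2) / P) with hH
  obtain ⟨u, hu⟩ : ∃ u, u = 1 - r ^ 2 / q ^ 2 := ⟨_, rfl⟩
  obtain ⟨w, hw⟩ : ∃ w, w = Q / P - 1 := ⟨_, rfl⟩
  obtain ⟨b, hb⟩ : ∃ b, b = 2 / α := ⟨_, rfl⟩
  have hu0 : 0 ≤ u := by rw [hu, sub_nonneg]; exact (div_le_one hq2).2 hRS
  have hw0 : 0 ≤ w := by rw [hw, sub_nonneg]; exact (one_le_div hP).2 hPQ
  have hb0 : 0 < b := by rw [hb]; positivity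
  have hb1 : b ≤ 1 := by rw [hb]; exact (div_le_one hα0).2 hα
  have hbw : b * w ≤ u * (1 + w) := by
    rw [← hu] at hB
    have e1 : P / Q * (1 + w) = 1 := by rw [hw]; field_simp; ring
    have e2 : b * (α / 2) = 1 := by rw [hb]; field_simp
    have e3 : (1 - α / 2 * u) * (1 + w) ≤ 1 := by
      exact (mul_le_mul_of_nonneg_right hB (by linarith : (0:ℝ) ≤ 1 + w)).trans_eq e1
    have e4 : b * ((1 - α / 2 * u) * (1 + w)) ≤ b * 1 := mul_le_mul_of_nonneg_left e3 hb0.le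
    have e5 : b * ((1 - α / 2 * u) * (1 + w)) = b * (1 + w) - (b * (α / 2)) * (u * (1 + w)) := by ring
    rw [e5, e2] at e4
    linarith
  have hsc := hill_scaled hb1 hu0 hw0 hbw
  have eQ : Q = α / q ^ 2 := by rw [← hS]; field_simp
  have er : r ^ 2 = q ^ 2 * (1 - u) := by rw [hu]; field_simp; ring
  have eP : 1 / P = (1 + w) / Q := by rw [hw]; field_simp; ring
  have ef : f = (α + 2) * q ^ 2 * (b * w - u) := by
    rw [hf, er, show (α + 2) / P = (α + 2) * (1 / P) by ring, eP, hb, eQ]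
    field_simp; ring
  have eH : H = (α + 2) * q ^ 2 * (u + (1 - b) * w) := by
    rw [hH, er, show (α - 2) / P = (α - 2) * (1 / P) by ring, eP, hb, eQ]
    field_simp; ring
  have hH0 : 0 ≤ H := by
    rw [eH]
    have : 0 ≤ (1 - b) * w := mul_nonneg (by linarith) hw0
    positivity
  have hmain : 4 * r ^ 2 * f ≤ H ^ 2 := by
    rw [ef, eH, er]
    have e1 : 0 ≤ (α + 2) * q ^ 2 * q ^ 2 := by positivity
    have e2 := mul_le_mul_of_nonneg_left hsc e1
    have e3 : 0 ≤ (α - 2) * ((α + 2) * q ^ 2 * q ^ 2 * (u + (1 - b) * w) ^ 2) :=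
      mul_nonneg (by linarith) (by positivity)
    calc 4 * (q ^ 2 * (1 - u)) * ((α + 2) * q ^ 2 * (b * w - u))
        = 4 * ((α + 2) * q ^ 2 * q ^ 2 * ((1 - u) * (b * w - u))) := by ring
      _ ≤ 4 * ((α + 2) * q ^ 2 * q ^ 2 * (u + (1 - b) * w) ^ 2) := by linarith
      _ ≤ 4 * ((α + 2) * q ^ 2 * q ^ 2 * (u + (1 - b) * w) ^ 2) +
          (α - 2) * ((α + 2) * q ^ 2 * q ^ 2 * (u + (1 - b) * w) ^ 2) := by linarith
      _ = _ := by ring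
  have hxr : x ^ 2 ≤ r ^ 2 := by rw [hR]; linarith [sq_nonneg y]
  have hVf : vx ^ 2 + vy ^ 2 ≤ f := by
    have : (α + 2) * x ^ 2 ≤ (α + 2) * r ^ 2 :=
      mul_le_mul_of_nonneg_left hxr (by linarith)
    linarith
  have hWP : α / P = α * (1 / P) := by ring
  have hHid : H = (α + 2) * (α / P) - (α + 2) * q ^ 2 - f := by
    have e : q ^ 2 = α / Q := by rw [eQ]; field_simp
    rw [hH, hf, e]; ring
  have hl : (2 * (x * vy - vx * y)) ^ 2 ≤ H ^ 2 := by
    have : (x * vy - vx * y) ^ 2 ≤ r ^ 2 * (vx ^ 2 + vy ^ 2) := by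
      rw [hR]; nlinarith [sq_nonneg (x * vx + y * vy)]
    calc (2 * (x * vy - vx * y)) ^ 2 = 4 * (x * vy - vx * y) ^ 2 := by ring
      _ ≤ 4 * (r ^ 2 * (vx ^ 2 + vy ^ 2)) := by linarith
      _ ≤ 4 * (r ^ 2 * f) := by
        linarith [mul_le_mul_of_nonneg_left hVf (sq_nonneg r)]
      _ = 4 * r ^ 2 * f := by ring
      _ ≤ H ^ 2 := hmain
  have hl2 := abs_le_of_sq_le_sq hl hH0
  have hx : (α + 2) * x ^ 2 ≤ (α + 2) * r ^ 2 :=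
    mul_le_mul_of_nonneg_left hxr (by linarith)
  have hl3 := (le_abs_self _).trans hl2
  linarith

noncomputable def hillF (α : ℝ) (p : HillSt) : HillSt :=
  (p.2.2.1, p.2.2.2, 2 * p.2.2.2 - hillVx α p.1 p.2.1, -(2 * p.2.2.1) - hillVy α p.1 p.2.1)

def hillU : Set HillSt := {p | (p.1, p.2.1) ≠ ((0 : ℝ), (0 : ℝ))}

noncomputable def hillG (x y : ℝ → ℝ) (t : ℝ) : HillSt := (x t, y t, deriv x t, deriv y t)

def hillAt (α : ℝ) (x y : ℝ → ℝ) (t : ℝ) : Prop :=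
    (x t, y t) ≠ (0, 0) ∧
    HasDerivAt x (deriv x t) t ∧ HasDerivAt y (deriv y t) t ∧
    HasDerivAt (deriv x) (2 * deriv y t - hillVx α (x t) (y t)) t ∧
    HasDerivAt (deriv y) (-(2 * deriv x t) - hillVy α (x t) (y t)) t

lemma hillU_open : IsOpen hillU := by
  unfold hillU
  exact isOpen_ne_fun (by fun_prop) (by fun_prop)

lemma hillR_contDiffAt {p : HillSt} (hp : p ∈ hillU) :
    ContDiffAt ℝ 1 (fun q : HillSt => hillR q.1 q.2.1) p := by
  unfold hillR
  refine ContDiffAt.sqrt (by fun_prop) ?_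
  have := hillR_pos hp
  unfold hillR at this
  exact (Real.sqrt_pos.1 this).ne'

lemma hillF_contDiffAt (α : ℝ) : ∀ p ∈ hillU, ContDiffAt ℝ 1 (hillF α) p := by
  intro p hp
  have hr := hillR_contDiffAt hp
  have hpos := hillR_pos hp
  have hrp : ContDiffAt ℝ 1 (fun q : HillSt => hillR q.1 q.2.1 ^ (α + 2)) p :=
    hr.rpow_const_of_ne hpos.ne'
  have hne : hillR p.1 p.2.1 ^ (α + 2) ≠ 0 := (Real.rpow_pos_of_pos hpos _).ne'
  unfold hillF hillVx hillVy
  refine ContDiffAt.prodMk (by fun_prop) (ContDiffAt.prodMk (by fun_prop) (ContDiffAt.prodMk ?_ ?_))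
  · refine ContDiffAt.sub (by fun_prop) (ContDiffAt.add (by fun_prop) ?_)
    exact ContDiffAt.div (by fun_prop) hrp hne
  · refine ContDiffAt.sub (by fun_prop) ?_
    exact ContDiffAt.div (by fun_prop) hrp hne

lemma hillG_hasDerivAt {α : ℝ} {x y : ℝ → ℝ} {t : ℝ} (h : hillAt α x y t) :
    HasDerivAt (hillG x y) (hillF α (hillG x y t)) t ∧ hillG x y t ∈ hillU := by
  obtain ⟨h0, h1, h2, h3, h4⟩ := h
  exact ⟨h1.prodMk (h2.prodMk (h3.prodMk h4)), h0⟩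

lemma hillAt_congr {α : ℝ} {x y x₂ y₂ : ℝ → ℝ} {t : ℝ} (h : hillAt α x y t)
    (hx : x₂ =ᶠ[𝓝 t] x) (hy : y₂ =ᶠ[𝓝 t] y) : hillAt α x₂ y₂ t := by
  obtain ⟨h0, h1, h2, h3, h4⟩ := h
  have dx := hx.deriv
  have dy := hy.deriv
  unfold hillAt
  rw [hx.self_of_nhds, hy.self_of_nhds, dx.self_of_nhds, dy.self_of_nhds]
  exact ⟨h0, h1.congr_of_eventuallyEq hx, h2.congr_of_eventuallyEq hy,
    h3.congr_of_eventuallyEq dx, h4.congr_of_eventuallyEq dy⟩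

lemma hillAt_of_flow {α : ℝ} {z : ℝ → HillSt} {t : ℝ}
    (h : ∀ᶠ u in 𝓝 t, HasDerivAt z (hillF α (z u)) u) (hU : z t ∈ hillU) :
    hillAt α (fun u => (z u).1) (fun u => (z u).2.1) t := by
  have hd : ∀ u, HasDerivAt z (hillF α (z u)) u →
      HasDerivAt (fun u => (z u).1) (z u).2.2.1 u ∧ HasDerivAt (fun u => (z u).2.1) (z u).2.2.2 u ∧
      HasDerivAt (fun u => (z u).2.2.1) (hillF α (z u)).2.2.1 u ∧
      HasDerivAt (fun u => (z u).2.2.2) (hillF α (z u)).2.2.2 u := by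
    intro u hu
    have h1 := hu.hasFDerivAt.fst.hasDerivAt
    have h2 := hu.hasFDerivAt.snd.fst.hasDerivAt
    have h3 := hu.hasFDerivAt.snd.snd.fst.hasDerivAt
    have h4 := hu.hasFDerivAt.snd.snd.snd.hasDerivAt
    simp at h1 h2 h3 h4
    exact ⟨h1, h2, h3, h4⟩
  have dx : deriv (fun u => (z u).1) =ᶠ[𝓝 t] fun u => (z u).2.2.1 := by
    filter_upwards [h] with u hu using (hd u hu).1.deriv
  have dy : deriv (fun u => (z u).2.1) =ᶠ[𝓝 t] fun u => (z u).2.2.2 := by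
    filter_upwards [h] with u hu using (hd u hu).2.1.deriv
  obtain ⟨h1, h2, h3, h4⟩ := hd t h.self_of_nhds
  unfold hillAt
  rw [dx.self_of_nhds, dy.self_of_nhds]
  exact ⟨hU, h1, h2, h3.congr_of_eventuallyEq dx, h4.congr_of_eventuallyEq dy⟩

lemma hill_extend {α : ℝ} {x y : ℝ → ℝ} {T : ℝ} (hT : 0 < T)
    (hs : ∀ t, 0 ≤ t → t < T → hillAt α x y t) {p : HillSt} (hp : p ∈ hillU)
    (hc : MapClusterPt p (𝓝[<] T) (hillG x y)) :
    ∃ T' > T, ∃ x₂ y₂ : ℝ → ℝ, (∀ t, 0 ≤ t → t < T' → hillAt α x₂ y₂ t) ∧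
      ∀ t < T, x₂ t = x t ∧ y₂ t = y t := by
  obtain ⟨ρ, hρ, ε, hε, hflow⟩ := hill_local_flow hillU_open hp (hillF_contDiffAt α p hp)
  have hfr := hc.frequently (Metric.ball_mem_nhds p hρ)
  have hev : ∀ᶠ t in 𝓝[<] T, max 0 (T - ε) < t ∧ t < T := by
    exact Ioo_mem_nhdsLT (max_lt hT (by linarith))
  obtain ⟨t1, hb, ht1, ht1T⟩ := (hfr.and_eventually hev).exists
  obtain ⟨ht10, ht1ε⟩ := max_lt_iff.1 ht1
  obtain ⟨z, hz0, hz⟩ := hflow _ hb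
  obtain ⟨w, hw⟩ : ∃ w : ℝ → HillSt, w = fun t => z (t - t1) := ⟨_, rfl⟩
  have hw' : ∀ t ∈ Ioo (t1 - ε) (t1 + ε), HasDerivAt w (hillF α (w t)) t ∧ w t ∈ hillU := by
    intro t ht
    have := hz (t - t1) ⟨by linarith [ht.1], by linarith [ht.2]⟩
    rw [hw]
    exact ⟨this.1.comp_sub_const t t1, this.2⟩
  have hagree : EqOn (hillG x y) w (Ioo (max 0 (t1 - ε)) T) := by
    refine hill_ode_unique (hillF_contDiffAt α) (t0 := t1) ⟨max_lt ht10 (by linarith), ht1T⟩ ?_ ?_ ?_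
    · intro t ht
      obtain ⟨h1, h2⟩ := max_lt_iff.1 ht.1
      exact hillG_hasDerivAt (hs t h1.le ht.2)
    · intro t ht
      obtain ⟨h1, h2⟩ := max_lt_iff.1 ht.1
      exact hw' t ⟨h2, by linarith [ht.2]⟩
    · rw [hw]; simp [hz0]
  refine ⟨t1 + ε, by linarith, fun t => if t < T then x t else (w t).1,
    fun t => if t < T then y t else (w t).2.1, ?_, ?_⟩
  · intro t ht0 ht
    rcases lt_or_ge t T with htT | htT
    · refine hillAt_congr (hs t ht0 htT) ?_ ?_
      · filter_upwards [Iio_mem_nhds htT] with u hu using if_pos hu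
      · filter_upwards [Iio_mem_nhds htT] with u hu using if_pos hu
    · have hm : Ioo (max 0 (t1 - ε)) (t1 + ε) ∈ 𝓝 t :=
        Ioo_mem_nhds (lt_of_lt_of_le (max_lt hT (by linarith)) htT) ht
      have hm2 : ∀ᶠ u in 𝓝 t, HasDerivAt w (hillF α (w u)) u := by
        filter_upwards [hm] with u hu
        exact (hw' u ⟨(max_lt_iff.1 hu.1).2, hu.2⟩).1
      have hm3 := mem_of_mem_nhds hm
      refine hillAt_congr (hillAt_of_flow hm2 (hw' t ⟨(max_lt_iff.1 hm3.1).2, hm3.2⟩).2) ?_ ?_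
      · filter_upwards [hm] with u hu
        split_ifs with h
        · exact congrArg Prod.fst (hagree ⟨hu.1, h⟩)
        · rfl
      · filter_upwards [hm] with u hu
        split_ifs with h
        · exact congrArg (fun p : HillSt => p.2.1) (hagree ⟨hu.1, h⟩)
        · rfl
  · intro t ht
    simp [ht]

lemma hillR_rpow_add {α x y : ℝ} (h : (x, y) ≠ (0, 0)) :
    hillR x y ^ (α + 2) = hillR x y ^ α * (x ^ 2 + y ^ 2) := by
  rw [Real.rpow_add (hillR_pos h), ← hillR_sq, Real.rpow_two]

lemma hill_energy_deriv {α : ℝ} {x y : ℝ → ℝ} {t : ℝ} (h : hillAt α x y t) :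
    HasDerivAt (fun t => hillE α (x t) (y t) (deriv x t) (deriv y t)) 0 t := by
  obtain ⟨h0, h1, h2, h3, h4⟩ := h
  have hpos := hillR_pos h0
  have hsq : x t ^ 2 + y t ^ 2 ≠ 0 := by rw [← hillR_sq]; positivity
  have hr : HasDerivAt (fun t => hillR (x t) (y t))
      ((x t * deriv x t + y t * deriv y t) / hillR (x t) (y t)) t := by
    have := ((h1.pow 2).add (h2.pow 2)).sqrt hsq
    refine this.congr_deriv ?_
    unfold hillR at hpos ⊢
    simp
    field_simp
  have hra := (hr.rpow_const (p := α) (Or.inl hpos.ne'))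
  have hP : 0 < hillR (x t) (y t) ^ α := by positivity
  have hV := (((h3.pow 2).add (h4.pow 2)).const_mul (1 / 2 : ℝ)).add
    (((h1.pow 2).const_mul (-((α + 2) / 2))).sub ((hasDerivAt_const t (α + 2)).div hra hP.ne'))
  unfold hillE hillV
  refine hV.congr_deriv ?_
  unfold hillVx hillVy
  rw [hillR_rpow_add h0, Real.rpow_sub_one hpos.ne', ← hillR_sq]
  simp
  field_simp
  ring

lemma hill_rsq_deriv {α : ℝ} {x y : ℝ → ℝ} {t : ℝ} (h : hillAt α x y t) :
    HasDerivAt (fun t => x t ^ 2 + y t ^ 2) (2 * (x t * deriv x t + y t * deriv y t)) t ∧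
    HasDerivAt (fun t => 2 * (x t * deriv x t + y t * deriv y t))
      (2 * hillK α (x t) (y t) (deriv x t) (deriv y t)) t := by
  obtain ⟨h0, h1, h2, h3, h4⟩ := h
  have hpos := hillR_pos h0
  have hsq : x t ^ 2 + y t ^ 2 ≠ 0 := by rw [← hillR_sq]; positivity
  have hP : 0 < hillR (x t) (y t) ^ α := by positivity
  constructor
  · refine ((h1.pow 2).add (h2.pow 2)).congr_deriv ?_
    simp; ring
  · refine (((h1.mul h3).add (h2.mul h4)).const_mul 2).congr_deriv ?_
    unfold hillVx hillVy hillK hillW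
    rw [hillR_rpow_add h0]
    field_simp
    ring

lemma hill_mono_lin {f f' : ℝ → ℝ} {a m : ℝ} (hf : ∀ t, a ≤ t → HasDerivAt f (f' t) t)
    (hm : ∀ t, a ≤ t → m ≤ f' t) : ∀ t, a ≤ t → f a + m * (t - a) ≤ f t := by
  intro t ht
  have := (convex_Icc a t).mul_sub_le_image_sub_of_le_deriv (f := f) (C := m)
    (fun u hu => (hf u hu.1).continuousAt.continuousWithinAt)
    (fun u hu => (hf u (interior_subset hu).1).differentiableAt.differentiableWithinAt)
    (fun u hu => by rw [(hf u (interior_subset hu).1).deriv]; exact hm u (interior_subset hu).1)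
    a (left_mem_Icc.2 ht) t (right_mem_Icc.2 ht) ht
  linarith

lemma hill_conv {J J1 J2 : ℝ → ℝ} {c B : ℝ} (hc : 0 < c)
    (h1 : ∀ t, 0 ≤ t → HasDerivAt J (J1 t) t) (h2 : ∀ t, 0 ≤ t → HasDerivAt J1 (J2 t) t)
    (h3 : ∀ t, 0 ≤ t → c * J t ≤ J2 t) (h4 : ∀ t, 0 ≤ t → 0 ≤ J t) (h5 : ∀ t, 0 ≤ t → J t ≤ B) :
    Tendsto J atTop (𝓝 0) := by
  have hJ1 : ∀ t, 0 ≤ t → J1 t ≤ 0 := by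
    intro t0 ht0
    by_contra hpos; push Not at hpos
    have hmono : ∀ t, t0 ≤ t → J1 t0 ≤ J1 t := by
      intro t ht
      have := hill_mono_lin (f := J1) (a := t0) (m := 0) (fun u hu => h2 u (ht0.trans hu))
        (fun u hu => (mul_nonneg hc.le (h4 u (ht0.trans hu))).trans (h3 u (ht0.trans hu))) t ht
      linarith
    have hl := hill_mono_lin (f := J) (a := t0) (m := J1 t0) (fun u hu => h1 u (ht0.trans hu)) hmono
    have hB : 0 ≤ B := (h4 0 le_rfl).trans (h5 0 le_rfl)
    have hge : t0 ≤ t0 + (B + 1) / J1 t0 := by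
      have : 0 ≤ (B + 1) / J1 t0 := by positivity
      linarith
    have h6 := hl _ hge
    have h7 := h5 _ (ht0.trans hge)
    have h8 : J1 t0 * (t0 + (B + 1) / J1 t0 - t0) = B + 1 := by field_simp; ring
    have h9 := h4 t0 ht0
    linarith
  have hanti : ∀ s t, 0 ≤ s → s ≤ t → J t ≤ J s := by
    intro s t hs hst
    have := hill_mono_lin (f := fun u => - J u) (f' := fun u => - J1 u) (a := s) (m := 0)
      (fun u hu => (h1 u (hs.trans hu)).neg)
      (fun u hu => by linarith [hJ1 u (hs.trans hu)]) t hst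
    linarith
  rw [Metric.tendsto_atTop]
  intro ε hε
  obtain ⟨t, ht0, ht⟩ : ∃ t, 0 ≤ t ∧ J t < ε := by
    by_contra hno; push Not at hno
    have hl := hill_mono_lin (f := J1) (a := 0) (m := c * ε) h2
      (fun u hu => (mul_le_mul_of_nonneg_left (hno u hu) hc.le).trans (h3 u hu))
    have hp : 0 < c * ε := by positivity
    have hge : 0 ≤ (|J1 0| + 1) / (c * ε) := by positivity
    have h6 := hl _ hge
    have h7 := hJ1 _ hge
    have h8 : c * ε * ((|J1 0| + 1) / (c * ε) - 0) = |J1 0| + 1 := by field_simp; ring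
    linarith [neg_abs_le (J1 0)]
  refine ⟨t, fun s hs => ?_⟩
  rw [Real.dist_eq, sub_zero, abs_of_nonneg (h4 s (ht0.trans hs))]
  exact (hanti t s ht0 hs).trans_lt ht

lemma hill_pos_persist {f : ℝ → ℝ} {t0 : ℝ} (hc : ∀ t, t0 ≤ t → ContinuousAt f t)
    (hne : ∀ t, t0 ≤ t → f t ≠ 0) (h0 : 0 < f t0) : ∀ t, t0 ≤ t → 0 < f t := by
  intro t ht
  by_contra hcon; push Not at hcon
  obtain ⟨u, hu, hu0⟩ := intermediate_value_Icc' ht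
    (fun u hu => (hc u hu.1).continuousWithinAt) (show (0:ℝ) ∈ Icc (f t) (f t0) from ⟨hcon, h0.le⟩)
  exact hne u hu.1 hu0

lemma hill_sqrt_tendsto {l : Filter ℝ} {f : ℝ → ℝ} {a : ℝ} (ha : 0 ≤ a)
    (h : Tendsto (fun t => f t ^ 2) l (𝓝 (a ^ 2))) : Tendsto (fun t => |f t|) l (𝓝 a) := by
  have := h.sqrt
  simpa [Real.sqrt_sq_eq_abs, abs_of_nonneg ha] using this

lemma hill_sq_zero {l : Filter ℝ} {f : ℝ → ℝ}
    (h : Tendsto (fun t => f t ^ 2) l (𝓝 0)) : Tendsto f l (𝓝 0) := by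
  refine (tendsto_zero_iff_abs_tendsto_zero f).2 ?_
  exact hill_sqrt_tendsto le_rfl (by simpa using h)

/-- vector field vanishes at the ground states -/
lemma hill_gs_F {α c q : ℝ} (hα : 2 ≤ α) (hq : q = α ^ ((1 : ℝ) / (α + 2))) (hc : c = q ∨ c = -q) :
    hillF α (c, 0, 0, 0) = 0 ∧ hillK α c 0 0 0 = 0 ∧ ((c, 0, 0, 0) : HillSt) ∈ hillU := by
  obtain ⟨q', Q, hq', hqp, hQ, hQq, hS, hEs⟩ := hill_q_facts hα
  obtain rfl : q = q' := hq.trans hq'.symm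
  have hc2 : c ^ 2 = q ^ 2 := by rcases hc with rfl | rfl <;> ring
  have hc0 : c ≠ 0 := by rcases hc with rfl | rfl <;> [exact hqp.ne'; exact (neg_neg_of_pos hqp).ne]
  have hne : (c, (0:ℝ)) ≠ (0, 0) := by simp [hc0]
  have hR : hillR c 0 = q := by
    unfold hillR; rw [hc2]; simp [Real.sqrt_sq hqp.le]
  have hRa : hillR c 0 ^ (α + 2) = α := by
    rw [hillR_rpow_add hne, hR, ← hQq, hc2]; linarith
  have hα0 : α ≠ 0 := by linarith
  refine ⟨?_, ?_, hne⟩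
  · unfold hillF hillVx hillVy
    simp only [hRa]
    ext <;> simp
    field_simp; ring
  · unfold hillK hillW
    rw [hR, ← hQq, hc2, show α / Q = q ^ 2 by rw [← hS]; field_simp]
    ring

lemma hill_not_gs {α q : ℝ} (hα : 2 ≤ α) (hq : q = α ^ ((1 : ℝ) / (α + 2))) {x y : ℝ → ℝ} {b : ℝ}
    (hs : ∀ t, 0 ≤ t → t < b → hillAt α x y t)
    (hK : hillK α (x 0) (y 0) (deriv x 0) (deriv y 0) < 0) {c : ℝ} (hc : c = q ∨ c = -q)
    {t : ℝ} (ht0 : 0 ≤ t) (htb : t < b) : hillG x y t ≠ (c, 0, 0, 0) := by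
  intro he
  obtain ⟨hF, hK0, hU⟩ := hill_gs_F hα hq hc
  have h0 : hillG x y 0 = (c, 0, 0, 0) := by
    rcases ht0.eq_or_lt with rfl | htp
    · exact he
    · have heq : EqOn (hillG x y) (fun _ => ((c, 0, 0, 0) : HillSt)) (Ioo 0 b) := by
        refine hill_ode_unique (hillF_contDiffAt α) (t0 := t) ⟨htp, htb⟩ ?_ ?_ he
        · intro u hu
          exact hillG_hasDerivAt (hs u hu.1.le hu.2)
        · intro u hu
          exact ⟨by rw [hF]; exact hasDerivAt_const _ _, hU⟩
      have hb : 0 < b := htp.trans htb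
      have h1 : Tendsto (hillG x y) (𝓝[>] 0) (𝓝 (hillG x y 0)) :=
        ((hillG_hasDerivAt (hs 0 le_rfl hb)).1.continuousAt.tendsto).mono_left nhdsWithin_le_nhds
      have h2 : Tendsto (hillG x y) (𝓝[>] 0) (𝓝 (c, 0, 0, 0)) := by
        refine tendsto_const_nhds.congr' ?_
        filter_upwards [Ioo_mem_nhdsGT hb] with u hu using (heq hu).symm
      exact tendsto_nhds_unique h1 h2
  unfold hillG at h0
  simp only [Prod.mk.injEq] at h0
  obtain ⟨e1, e2, e3, e4⟩ := h0
  rw [e1, e2, e3, e4, hK0] at hK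
  exact lt_irrefl _ hK

/-- invariance -/
lemma hill_invariant {α : ℝ} (hα : 2 ≤ α) {x y : ℝ → ℝ} {b : ℝ}
    (hs : ∀ t, 0 ≤ t → t < b → hillAt α x y t)
    (hE : hillE α (x 0) (y 0) (deriv x 0) (deriv y 0) = hillEstar α)
    (hK : hillK α (x 0) (y 0) (deriv x 0) (deriv y 0) < 0)
    (hW : hillW α (x 0) (y 0) ≤ 0) {t : ℝ} (ht0 : 0 ≤ t) (htb : t < b) :
    hillE α (x t) (y t) (deriv x t) (deriv y t) = hillEstar α ∧ hillW α (x t) (y t) ≤ 0 := by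
  have hEt : ∀ u, 0 ≤ u → u < b →
      hillE α (x u) (y u) (deriv x u) (deriv y u) = hillEstar α := by
    intro u hu0 hub
    rw [← hE]
    refine constant_of_has_deriv_right_zero (a := 0) (b := u)
      (f := fun t => hillE α (x t) (y t) (deriv x t) (deriv y t)) ?_ ?_ u ⟨hu0, le_rfl⟩
    · intro s hs'
      exact (hill_energy_deriv (hs s hs'.1 (hs'.2.trans_lt hub))).continuousAt.continuousWithinAt
    · intro s hs'
      exact (hill_energy_deriv (hs s hs'.1 (hs'.2.trans hub))).hasDerivWithinAt
  have hWne : ∀ u, 0 ≤ u → u < b → hillW α (x u) (y u) ≠ 0 := by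
    intro u hu0 hub h0
    obtain ⟨h1, h2, h3, h4⟩ := hill_W_zero hα rfl (hs u hu0 hub).1 (hEt u hu0 hub) h0
    refine hill_not_gs hα rfl hs hK h1 hu0 hub ?_
    unfold hillG; rw [h2, h3, h4]
  have hWc : ∀ u, 0 ≤ u → u < b → ContinuousAt (fun s => hillW α (x s) (y s)) u := by
    intro u hu0 hub
    obtain ⟨h0, h1, h2, -, -⟩ := hs u hu0 hub
    have hpos := hillR_pos h0
    have hx := h1.continuousAt
    have hy := h2.continuousAt
    have hr : ContinuousAt (fun s => hillR (x s) (y s)) u := by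
      unfold hillR; exact ((hx.pow 2).add (hy.pow 2)).sqrt
    have hra := hr.rpow_const (p := α) (Or.inl hpos.ne')
    have hP : 0 < hillR (x u) (y u) ^ α := by positivity
    unfold hillW
    exact continuousAt_const.mul ((hx.pow 2).sub (continuousAt_const.div hra hP.ne'))
  refine ⟨hEt t ht0 htb, ?_⟩
  by_contra hcon; push Not at hcon
  obtain ⟨u, hu, hu0⟩ := intermediate_value_Icc ht0 (f := fun s => hillW α (x s) (y s))
    (fun u hu => (hWc u hu.1 (hu.2.trans_lt htb)).continuousWithinAt)
    (show (0:ℝ) ∈ Icc _ _ from ⟨hW, hcon.le⟩)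
  exact hWne u hu.1 (hu.2.trans_lt htb) hu0

lemma hill_global {α : ℝ} (hα : 2 ≤ α) {x y : ℝ → ℝ} (hs : ∀ t, 0 ≤ t → hillAt α x y t)
    (hI : ∀ t, 0 ≤ t → hillE α (x t) (y t) (deriv x t) (deriv y t) = hillEstar α ∧
      hillW α (x t) (y t) ≤ 0) :
    Tendsto (fun t => (x t, y t, deriv x t, deriv y t)) atTop
          (𝓝 ((α ^ ((1 : ℝ) / (α + 2)) : ℝ), (0 : ℝ), (0 : ℝ), (0 : ℝ))) ∨
        Tendsto (fun t => (x t, y t, deriv x t, deriv y t)) atTop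
          (𝓝 ((-(α ^ ((1 : ℝ) / (α + 2))) : ℝ), (0 : ℝ), (0 : ℝ), (0 : ℝ))) := by
  obtain ⟨q, Q, hq, hqp, hQ, hQq, hS, hEs⟩ := hill_q_facts hα
  rw [← hq]
  have hα2 : 0 < α + 2 := by linarith
  have hJ : Tendsto (fun t => q ^ 2 - (x t ^ 2 + y t ^ 2)) atTop (𝓝 0) := by
    refine hill_conv (J1 := fun t => -(2 * (x t * deriv x t + y t * deriv y t)))
      (J2 := fun t => -(2 * hillK α (x t) (y t) (deriv x t) (deriv y t)))
      (c := 2 * (α + 2)) (B := q ^ 2) (by positivity) ?_ ?_ ?_ ?_ ?_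
    · intro t ht; exact (hill_rsq_deriv (hs t ht)).1.const_sub _
    · intro t ht; exact (hill_rsq_deriv (hs t ht)).2.neg
    · intro t ht
      have := hill_K_le hα hq (hs t ht).1 (hI t ht).1 (hI t ht).2
      linarith
    · intro t ht
      have h1 := hill_r_le hα hq (hs t ht).1 (hI t ht).1 (hI t ht).2
      have h2 := hillR_pos (hs t ht).1
      rw [← hillR_sq]; nlinarith
    · intro t ht
      linarith [sq_nonneg (x t), sq_nonneg (y t)]
  have hR : Tendsto (fun t => x t ^ 2 + y t ^ 2) atTop (𝓝 (q ^ 2)) := by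
    have := hJ.const_sub (q ^ 2)
    simpa using this
  have hr : Tendsto (fun t => hillR (x t) (y t)) atTop (𝓝 q) := by
    have := hR.sqrt
    rw [Real.sqrt_sq hqp.le] at this
    exact this
  have hP : Tendsto (fun t => hillR (x t) (y t) ^ α) atTop (𝓝 Q) := by
    rw [hQq]; exact hr.rpow_const (Or.inl hqp.ne')
  have hinv : Tendsto (fun t => 2 / hillR (x t) (y t) ^ α) atTop (𝓝 (2 / Q)) :=
    tendsto_const_nhds.div hP hQ.ne'
  have hv : ∀ t, 0 ≤ t → deriv x t ^ 2 + deriv y t ^ 2 =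
      (α + 2) * (x t ^ 2 + 2 / hillR (x t) (y t) ^ α - (α + 2) / Q) := by
    intro t ht
    have := (hI t ht).1
    unfold hillE hillV at this
    have e : (α + 2) * (x t ^ 2 + 2 / hillR (x t) (y t) ^ α - (α + 2) / Q)
      = (α + 2) * x t ^ 2 + 2 * ((α + 2) / hillR (x t) (y t) ^ α) + - (α + 2) ^ 2 / Q := by ring
    rw [e, ← hEs]
    linarith
  have hqQ : (α + 2) / Q - 2 / Q = q ^ 2 := by rw [← hS]; field_simp; ring
  have hx2 : Tendsto (fun t => x t ^ 2) atTop (𝓝 (q ^ 2)) := by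
    have hlow : Tendsto (fun t => (α + 2) / Q - 2 / hillR (x t) (y t) ^ α) atTop (𝓝 (q ^ 2)) := by
      rw [← hqQ]; exact hinv.const_sub _
    refine tendsto_of_tendsto_of_tendsto_of_le_of_le' hlow hR ?_ ?_
    · filter_upwards [eventually_ge_atTop 0] with t ht
      have h1 := hv t ht
      have h2 : 0 ≤ (α + 2) * (x t ^ 2 + 2 / hillR (x t) (y t) ^ α - (α + 2) / Q) := by
        rw [← h1]; positivity
      have := nonneg_of_mul_nonneg_right h2 hα2
      linarith
    · exact Eventually.of_forall fun t => by linarith [sq_nonneg (y t)]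
  have hy : Tendsto y atTop (𝓝 0) := by
    refine hill_sq_zero ?_
    have := hR.sub hx2
    simpa using this
  have hvv : Tendsto (fun t => deriv x t ^ 2 + deriv y t ^ 2) atTop (𝓝 0) := by
    have h1 := ((hx2.add hinv).sub_const ((α + 2) / Q)).const_mul (α + 2)
    have e : (α + 2) * (q ^ 2 + 2 / Q - (α + 2) / Q) = 0 := by rw [← hqQ]; ring
    rw [e] at h1
    refine h1.congr' ?_
    filter_upwards [eventually_ge_atTop 0] with t ht using (hv t ht).symm
  have hvx : Tendsto (deriv x) atTop (𝓝 0) :=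
    hill_sq_zero (squeeze_zero (fun t => sq_nonneg _)
      (fun t => by linarith [sq_nonneg (deriv y t)]) hvv)
  have hvy : Tendsto (deriv y) atTop (𝓝 0) :=
    hill_sq_zero (squeeze_zero (fun t => sq_nonneg _)
      (fun t => by linarith [sq_nonneg (deriv x t)]) hvv)
  have hax := hill_sqrt_tendsto hqp.le hx2
  obtain ⟨t0, ht0⟩ := eventually_atTop.1 (hax.eventually (lt_mem_nhds hqp))
  set t1 := max t0 0 with ht1
  have hne : ∀ t, t1 ≤ t → x t ≠ 0 := fun t ht =>
    abs_pos.1 (ht0 t ((le_max_left _ _).trans ht))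
  have hc : ∀ t, t1 ≤ t → ContinuousAt x t := fun t ht =>
    (hs t ((le_max_right _ _).trans ht)).2.1.continuousAt
  rcases (hne t1 le_rfl).lt_or_gt with hneg | hpos
  · right
    have h1 := hill_pos_persist (f := fun t => - x t) (fun t ht => (hc t ht).neg)
      (fun t ht => neg_ne_zero.2 (hne t ht)) (by simpa using hneg)
    have hx : Tendsto x atTop (𝓝 (-q)) := by
      refine hax.neg.congr' ?_
      filter_upwards [eventually_ge_atTop t1] with t ht
      rw [abs_of_neg (by linarith [h1 t ht])]; ring
    exact hx.prodMk_nhds (hy.prodMk_nhds (hvx.prodMk_nhds hvy))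
  · left
    have h1 := hill_pos_persist hc hne hpos
    have hx : Tendsto x atTop (𝓝 q) := by
      refine hax.congr' ?_
      filter_upwards [eventually_ge_atTop t1] with t ht
      rw [abs_of_pos (h1 t ht)]
    exact hx.prodMk_nhds (hy.prodMk_nhds (hvx.prodMk_nhds hvy))

lemma hill_collide {α : ℝ} (hα : 2 ≤ α) {x y : ℝ → ℝ} {T : ℝ} (hT : 0 < T)
    (hs : ∀ t, 0 ≤ t → t < T → hillAt α x y t)
    (hI : ∀ t, 0 ≤ t → t < T → hillE α (x t) (y t) (deriv x t) (deriv y t) = hillEstar α ∧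
      hillW α (x t) (y t) ≤ 0)
    (hno : ¬ ∃ T' > T, ∃ x₂ y₂ : ℝ → ℝ, (∀ t, 0 ≤ t → t < T' → hillAt α x₂ y₂ t) ∧
      ∀ t < T, x₂ t = x t ∧ y₂ t = y t) :
    Tendsto (fun t => (x t, y t)) (𝓝[<] T) (𝓝 ((0 : ℝ), (0 : ℝ))) := by
  obtain ⟨q, Q, hq, hqp, hQ, hQq, hS, hEs⟩ := hill_q_facts hα
  have hα2 : 0 < α + 2 := by linarith
  suffices hR : Tendsto (fun t => x t ^ 2 + y t ^ 2) (𝓝[<] T) (𝓝 0) by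
    have hx : Tendsto x (𝓝[<] T) (𝓝 0) :=
      hill_sq_zero (squeeze_zero (fun t => sq_nonneg _) (fun t => by linarith [sq_nonneg (y t)]) hR)
    have hy : Tendsto y (𝓝[<] T) (𝓝 0) :=
      hill_sq_zero (squeeze_zero (fun t => sq_nonneg _) (fun t => by linarith [sq_nonneg (x t)]) hR)
    exact hx.prodMk_nhds hy
  by_contra hcon
  rw [Metric.tendsto_nhds] at hcon
  push Not at hcon
  obtain ⟨ε, hε, hfr⟩ := hcon
  apply hno
  obtain ⟨M, hM⟩ : ∃ M, M = (α + 2) * q ^ 2 + 2 * ((α + 2) / (√ε) ^ α) := ⟨_, rfl⟩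
  have hM0 : 0 ≤ M := by rw [hM]; positivity
  let C : Set HillSt := {p | ε ≤ p.1 ^ 2 + p.2.1 ^ 2} ∩
    (Icc (-q) q ×ˢ Icc (-q) q ×ˢ Icc (-√M) (√M) ×ˢ Icc (-√M) (√M))
  have hC : IsCompact C := by
    refine IsCompact.inter_left ?_ (isClosed_le (by fun_prop) (by fun_prop))
    exact isCompact_Icc.prod (isCompact_Icc.prod (isCompact_Icc.prod isCompact_Icc))
  have hev : ∀ᶠ t in 𝓝[<] T, t ∈ Ioo 0 T := Ioo_mem_nhdsLT hT
  have hfr2 : ∃ᶠ t in 𝓝[<] T, hillG x y t ∈ C := by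
    refine (Filter.Frequently.and_eventually hfr hev).mono ?_
    rintro t ⟨h1, h2⟩
    have hat := hs t h2.1.le h2.2
    obtain ⟨hEt, hWt⟩ := hI t h2.1.le h2.2
    have hr := hillR_pos hat.1
    have hrq := hill_r_le hα hq hat.1 hEt hWt
    have hsq := hillR_sq (x t) (y t)
    have h1' : ε ≤ x t ^ 2 + y t ^ 2 := by
      rwa [Real.dist_eq, sub_zero, abs_of_nonneg (by positivity)] at h1
    have hR2 : x t ^ 2 + y t ^ 2 ≤ q ^ 2 := by rw [← hsq]; nlinarith
    have hse : √ε ≤ hillR (x t) (y t) := Real.sqrt_le_sqrt h1'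
    have hse0 : 0 < √ε := Real.sqrt_pos.2 hε
    have hpw : (√ε) ^ α ≤ hillR (x t) (y t) ^ α := Real.rpow_le_rpow hse0.le hse (by linarith)
    have hdiv : (α + 2) / hillR (x t) (y t) ^ α ≤ (α + 2) / (√ε) ^ α :=
      div_le_div_of_nonneg_left hα2.le (by positivity) hpw
    have hvM : deriv x t ^ 2 + deriv y t ^ 2 ≤ M := by
      unfold hillE hillV at hEt
      have e1 : - (α + 2) ^ 2 / Q ≤ 0 := by
        have : 0 ≤ (α + 2) ^ 2 / Q := by positivity
        rw [neg_div]; linarith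
      have e2 : (α + 2) * x t ^ 2 ≤ (α + 2) * q ^ 2 :=
        mul_le_mul_of_nonneg_left (by linarith [sq_nonneg (y t)]) hα2.le
      rw [hM]
      linarith
    refine ⟨h1', ?_, ?_, ?_, ?_⟩
    · exact abs_le.1 (abs_le_of_sq_le_sq (by show x t ^ 2 ≤ _; linarith [sq_nonneg (y t)]) hqp.le)
    · exact abs_le.1 (abs_le_of_sq_le_sq (by show y t ^ 2 ≤ _; linarith [sq_nonneg (x t)]) hqp.le)
    · exact abs_le.1 (Real.abs_le_sqrt (by show deriv x t ^ 2 ≤ _; linarith [sq_nonneg (deriv y t)]))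
    · exact abs_le.1 (Real.abs_le_sqrt (by show deriv y t ^ 2 ≤ _; linarith [sq_nonneg (deriv x t)]))
  obtain ⟨p, hpC, hp⟩ := hC.exists_mapClusterPt_of_frequently hfr2
  have hpU : p ∈ hillU := by
    intro h0
    have h1 : ε ≤ p.1 ^ 2 + p.2.1 ^ 2 := hpC.1
    simp only [Prod.mk.injEq] at h0
    rw [h0.1, h0.2] at h1
    norm_num at h1
    linarith
  exact hill_extend hT hs hpU hp

/-- for α ≥ 2, solutions in 𝒲̃₋⁻ = {E = E*, K < 0, W ≤ 0} either collide
with the origin in finite time, or exist globally and converge to one of the ground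
states ±Q = (±α^{1/(α+2)}, 0, 0, 0) as t → ∞. -/
theorem hill_at_ground_state_dichotomy
    (α : ℝ) (hα : 2 ≤ α) (Tmax : ℝ≥0∞) (hT : 0 < Tmax) (x y : ℝ → ℝ)
    (hsol : HillMaxSol α x y Tmax)
    (hE : hillE α (x 0) (y 0) (deriv x 0) (deriv y 0) = hillEstar α)
    (hK : hillK α (x 0) (y 0) (deriv x 0) (deriv y 0) < 0)
    (hW : hillW α (x 0) (y 0) ≤ 0) :
    (Tmax ≠ ⊤ ∧
      Tendsto (fun t => (x t, y t)) (𝓝[<] Tmax.toReal) (𝓝 ((0 : ℝ), (0 : ℝ)))) ∨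
    (Tmax = ⊤ ∧
      (Tendsto (fun t => (x t, y t, deriv x t, deriv y t)) atTop
          (𝓝 ((α ^ ((1 : ℝ) / (α + 2)) : ℝ), (0 : ℝ), (0 : ℝ), (0 : ℝ))) ∨
        Tendsto (fun t => (x t, y t, deriv x t, deriv y t)) atTop
          (𝓝 ((-(α ^ ((1 : ℝ) / (α + 2))) : ℝ), (0 : ℝ), (0 : ℝ), (0 : ℝ))))) := by
  obtain ⟨hs, hmax⟩ := hsol
  by_cases hTop : Tmax = ⊤
  · right
    refine ⟨hTop, ?_⟩
    have hs' : ∀ t, 0 ≤ t → hillAt α x y t := fun t ht =>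
      hs t ⟨ht, by rw [hTop]; exact ENNReal.ofReal_lt_top⟩
    exact hill_global hα hs' fun t ht =>
      hill_invariant hα (b := t + 1) (fun u hu _ => hs' u hu) hE hK hW ht (by linarith)
  · left
    refine ⟨hTop, ?_⟩
    have hTpos : 0 < Tmax.toReal := ENNReal.toReal_pos hT.ne' hTop
    have hs' : ∀ t, 0 ≤ t → t < Tmax.toReal → hillAt α x y t := fun t ht htT =>
      hs t ⟨ht, (ENNReal.ofReal_lt_iff_lt_toReal ht hTop).2 htT⟩
    refine hill_collide hα hTpos hs' (fun t ht htT => hill_invariant hα hs' hE hK hW ht htT) ?_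
    rintro ⟨T', hT', x₂, y₂, h1, h2⟩
    have hT'0 : 0 < T' := hTpos.trans hT'
    refine hmax (ENNReal.ofReal T') ((ENNReal.lt_ofReal_iff_toReal_lt hTop).2 hT') ⟨x₂, y₂, ?_, ?_⟩
    · intro t ht
      exact h1 t ht.1 ((ENNReal.ofReal_lt_ofReal_iff hT'0).1 ht.2)
    · intro t ht
      exact h2 t ((ENNReal.ofReal_lt_iff_lt_toReal ht.1 hTop).1 ht.2)
end

section
/- Fix a real parameter α > 0 and set q₀ = α^{1/(α+2)}. Let S be the 4×4 real matrix S = [[1−(α+2)², 0, 0, −1], [0, 1+(α+2), 1, 0], [0, 1, 1, 0], [−1, 0, 0, 1]] and let J = [[0,0,1,0],[0,0,0,1],[−1,0,0,0],[0,−1,0,0]] be the standard 4×4 symplectic matrix. Then the eigenvalues (over ℂ) of A = J S are exactly k, −k, iω, −iω, where k = (1/√2)·√( √(36 + 36α + 29α² + 10α³ + α⁴) + (α² + 3α − 2) ) and ω = (1/√2)·√( √(36 + 36α + 29α² + 10α³ + α⁴) − (α² + 3α − 2) ); in particular k > 0 and ω > 0. -/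
open Matrix Complex

/-- The exponential rate k of the hyperbolic eigenvalues ±k of the linearization. -/
noncomputable def hillk (α : ℝ) : ℝ :=
  (1 / Real.sqrt 2) *
    Real.sqrt (Real.sqrt (36 + 36 * α + 29 * α ^ 2 + 10 * α ^ 3 + α ^ 4) +
      (α ^ 2 + 3 * α - 2))

/-- The frequency ω of the elliptic eigenvalues ±iω of the linearization. -/
noncomputable def hillω (α : ℝ) : ℝ :=
  (1 / Real.sqrt 2) *
    Real.sqrt (Real.sqrt (36 + 36 * α + 29 * α ^ 2 + 10 * α ^ 3 + α ^ 4) -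
      (α ^ 2 + 3 * α - 2))

/-- The Hessian S = ∇²E(Q̃) of the Hamiltonian at the equilibrium Q̃. -/
noncomputable def hillHessian (α : ℝ) : Matrix (Fin 4) (Fin 4) ℝ :=
  !![1 - (α + 2) ^ 2, 0, 0, -1;
     0, 1 + (α + 2), 1, 0;
     0, 1, 1, 0;
     -1, 0, 0, 1]

/-- The standard 4×4 symplectic matrix J. -/
def hillJ4 : Matrix (Fin 4) (Fin 4) ℝ :=
  !![0, 0, 1, 0;
     0, 0, 0, 1;
     -1, 0, 0, 0;
     0, -1, 0, 0]

theorem hill_aux (α : ℝ) (hα : 0 < α) : 0 < hillk α ∧ 0 < hillω α ∧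
    hillk α ^ 2 - hillω α ^ 2 = α ^ 2 + 3 * α - 2 ∧
    hillk α ^ 2 * hillω α ^ 2 = (α + 2) ^ 3 := by
  have hD : (0:ℝ) ≤ 36 + 36 * α + 29 * α ^ 2 + 10 * α ^ 3 + α ^ 4 := by positivity
  have hlt : |α ^ 2 + 3 * α - 2| <
      Real.sqrt (36 + 36 * α + 29 * α ^ 2 + 10 * α ^ 3 + α ^ 4) := by
    apply Real.lt_sqrt_of_sq_lt
    rw [sq_abs]
    have : 0 < (α + 2) ^ 3 := by positivity
    nlinarith
  have hs := Real.sq_sqrt hD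
  unfold hillk hillω
  set s := Real.sqrt (36 + 36 * α + 29 * α ^ 2 + 10 * α ^ 3 + α ^ 4)
  obtain ⟨h1, h2⟩ := abs_lt.mp hlt
  have p1 : 0 < s + (α ^ 2 + 3 * α - 2) := by linarith
  have p2 : 0 < s - (α ^ 2 + 3 * α - 2) := by linarith
  refine ⟨by positivity, by positivity, ?_, ?_⟩
  · simp only [mul_pow, div_pow, Real.sq_sqrt p1.le, Real.sq_sqrt p2.le,
      Real.sq_sqrt (zero_le_two : (0:ℝ) ≤ 2)]
    ring
  · simp only [mul_pow, div_pow, Real.sq_sqrt p1.le, Real.sq_sqrt p2.le,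
      Real.sq_sqrt (zero_le_two : (0:ℝ) ≤ 2)]
    linear_combination hs / 4

/-- the eigenvalues over ℂ of A = J∇²E(Q̃) are exactly k, −k, iω, −iω,
with k > 0 and ω > 0. -/
theorem hill_linearization_eigenvalues (α : ℝ) (hα : 0 < α) :
    spectrum ℂ ((hillJ4 * hillHessian α).map (Complex.ofReal ·)) =
      {(hillk α : ℂ), -(hillk α : ℂ), Complex.I * (hillω α : ℂ),
        -(Complex.I * (hillω α : ℂ))} ∧
    0 < hillk α ∧ 0 < hillω α := by
  obtain ⟨hk, hw, h1, h2⟩ := hill_aux α hα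
  refine ⟨?_, hk, hw⟩
  have h1' : (hillk α : ℂ) ^ 2 - (hillω α : ℂ) ^ 2 = (α:ℂ) ^ 2 + 3 * α - 2 := by
    exact_mod_cast h1
  have h2' : (hillk α : ℂ) ^ 2 * (hillω α : ℂ) ^ 2 = ((α:ℂ) + 2) ^ 3 := by
    exact_mod_cast h2
  generalize (hillk α : ℂ) = k at *
  generalize (hillω α : ℂ) = w at *
  ext z
  have hM : algebraMap ℂ (Matrix (Fin 4) (Fin 4) ℂ) z -
      (hillJ4 * hillHessian α).map (Complex.ofReal ·) =
      !![z, -1, -1, 0; 1, z, 0, -1; 1 - ((α:ℂ) + 2) ^ 2, 0, z, -1; 0, 1 + ((α:ℂ) + 2), 1, z] := by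
    ext i j
    fin_cases i <;> fin_cases j <;>
      simp [hillJ4, hillHessian, Matrix.mul_apply, Fin.sum_univ_four, Matrix.algebraMap_matrix_apply]
  have hdet : (!![z, -1, -1, 0; 1, z, 0, -1; 1 - ((α:ℂ) + 2) ^ 2, 0, z, -1;
      0, 1 + ((α:ℂ) + 2), 1, z] : Matrix (Fin 4) (Fin 4) ℂ).det =
      (z - k) * ((z + k) * ((z - Complex.I * w) * (z + Complex.I * w))) := by
    have e : (z - k) * ((z + k) * ((z - Complex.I * w) * (z + Complex.I * w))) =
        z ^ 4 - ((α:ℂ) ^ 2 + 3 * α - 2) * z ^ 2 - ((α:ℂ) + 2) ^ 3 := by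
      linear_combination (-z ^ 2) * h1' - h2' - (z ^ 2 - k ^ 2) * w ^ 2 * Complex.I_sq
    rw [e]
    simp [Matrix.det_succ_row_zero, Fin.sum_univ_succ, Fin.succAbove]
    ring
  rw [spectrum.mem_iff, hM, Matrix.isUnit_iff_isUnit_det, hdet, isUnit_iff_ne_zero, not_not]
  simp only [mul_eq_zero, sub_eq_zero, add_eq_zero_iff_eq_neg, Set.mem_insert_iff,
    Set.mem_singleton_iff]
end

section
/- Fix a real parameter α ≥ 2 and let L₁ = (−α^{1/(α+2)}, 0) and L₂ = (α^{1/(α+2)}, 0) be the Lagrange points. For every δ > 0 there exist ε(δ) > 0 and κ(δ) > 0 such that every phase point Γ = (x,y,ẋ,ẏ) ∈ ℝ⁴ with (x,y) ≠ (0,0) satisfying E(Γ) < E* + ε(δ)² and d_L(Γ) := min(dist((x,y), L₁), dist((x,y), L₂)) ≥ δ satisfies either (W(Γ) ≤ −κ(δ) and K(Γ) ≤ −κ(δ)) or W(Γ) ≥ κ(δ). -/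
open Real Set Filter Topology ENNReal

/-- Core scalar inequality. -/
lemma hill_core (α w p : ℝ) (hα : 2 ≤ α) (hw : 0 < w) (hw1 : w < 1) (hp : 1 ≤ p)
    (hpw : p * w ^ (α / 2) = 1) :
    4 * α * w * (-(α + 2) + α * w + 2 * p) ≤ (α + 2 - 2 * α * w + (α - 2) * p) ^ 2 := by
  have h1 : 1 + (α / 2 - 1) * (1 - 1 / w) ≤ w ^ (α / 2 - 1) := by
    have hlog : 1 - w⁻¹ ≤ Real.log w := Real.one_sub_inv_le_log_of_pos hw
    have h2 : w ^ (α / 2 - 1) = Real.exp (Real.log w * (α / 2 - 1)) := Real.rpow_def_of_pos hw _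
    have h3 := Real.add_one_le_exp (Real.log w * (α / 2 - 1))
    rw [h2, one_div]
    nlinarith
  have h2 : w ^ (α / 2) = w * w ^ (α / 2 - 1) := by
    rw [Real.rpow_sub_one hw.ne']
    field_simp
  have h3 : w + (α / 2 - 1) * (w - 1) ≤ w ^ (α / 2) := by
    rw [h2]
    have := mul_le_mul_of_nonneg_left h1 hw.le
    have e : w * (1 + (α / 2 - 1) * (1 - 1 / w)) = w + (α / 2 - 1) * (w - 1) := by
      field_simp
    linarith
  have h4 : p * w - (α / 2 - 1) * (1 - w) * p ≤ 1 := by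
    have := mul_le_mul_of_nonneg_left h3 (by linarith : (0:ℝ) ≤ p)
    nlinarith
  obtain ⟨m, rfl⟩ : ∃ m, w = 1 - m := ⟨1 - w, by ring⟩
  obtain ⟨P, rfl⟩ : ∃ P, p = 1 + P := ⟨p - 1, by ring⟩
  have hm : 0 ≤ m := by linarith
  have hP : 0 ≤ P := by linarith
  have hmP : 0 ≤ m * P := mul_nonneg hm hP
  have h5 : (1 - m) * (-(α + 2) + α * (1 - m) + 2 * (1 + P)) ≤ α * m ^ 2 + (α - 2) * (m * P) := by
    nlinarith
  have h6 := mul_le_mul_of_nonneg_left h5 (by linarith : (0:ℝ) ≤ 4 * α)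
  nlinarith [sq_nonneg m, mul_nonneg (mul_nonneg (by linarith : (0:ℝ) ≤ α) (by linarith : (0:ℝ) ≤ α - 2)) hmP,
    sq_nonneg ((α - 2) * P)]

lemma hill_inner (α c s0 r s : ℝ) (hα : 2 ≤ α) (hc : 0 < c) (hs0 : s0 * c ^ α = 1)
    (hcs : c ^ 2 = α * s0) (hr : 0 < r) (hrc : r < c) (hs : s * r ^ α = 1) :
    16 * r ^ 2 * (-(α + 2) ^ 2 * s0 + (α + 2) * r ^ 2 + 2 * (α + 2) * s) ≤
      ((α + 2) ^ 2 * s0 - 2 * (α + 2) * r ^ 2 + (α + 2) * (α - 2) * s) ^ 2 ∧ s0 ≤ s := by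
  have hra : 0 < r ^ α := Real.rpow_pos_of_pos hr _
  have hca : 0 < c ^ α := Real.rpow_pos_of_pos hc _
  have hle : r ^ α ≤ c ^ α := Real.rpow_le_rpow hr.le hrc.le (by linarith)
  have es0 : s0 = 1 / c ^ α := by field_simp; exact hs0
  have es : s = 1 / r ^ α := by field_simp; exact hs
  have hs0p : 0 < s0 := by rw [es0]; positivity
  have hss : s0 ≤ s := by
    rw [es0, es]; exact one_div_le_one_div_of_le hra hle
  refine ⟨?_, hss⟩
  have hw1 : (r / c) ^ 2 < 1 := by
    have : r / c < 1 := (div_lt_one hc).2 hrc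
    have h0 : 0 < r / c := by positivity
    nlinarith
  have hpow : ((r / c) ^ 2) ^ (α / 2) = r ^ α / c ^ α := by
    rw [← Real.div_rpow hr.le hc.le, ← Real.rpow_natCast, ← Real.rpow_mul (by positivity)]
    congr 1
    push_cast; ring
  have key := hill_core α ((r / c) ^ 2) (s / s0) hα (by positivity) hw1
    ((one_le_div hs0p).2 hss) (by rw [hpow, es, es0]; field_simp)
  have ew : s0 * α * (r / c) ^ 2 = r ^ 2 := by
    rw [div_pow, hcs]; field_simp
  have ep : s0 * (s / s0) = s := by field_simp
  generalize (r / c) ^ 2 = w at *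
  generalize s / s0 = p at *
  rw [← ew, ← ep]
  have h1 := mul_le_mul_of_nonneg_left key (by positivity : 0 ≤ 4 * (α + 2) * s0 ^ 2)
  have h2 : 0 ≤ (α + 2) * (α - 2) * s0 ^ 2 * (α + 2 - 2 * α * w + (α - 2) * p) ^ 2 := by
    have : 0 ≤ α - 2 := by linarith
    positivity
  nlinarith

lemma hill_dist (x y c δ : ℝ) (hc : 0 < c) (hδ : 0 < δ)
    (h : δ ≤ min (Real.sqrt ((x + c) ^ 2 + y ^ 2)) (Real.sqrt ((x - c) ^ 2 + y ^ 2))) :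
    δ ^ 2 ≤ |x ^ 2 - c ^ 2| + y ^ 2 := by
  have h1 := (Real.le_sqrt hδ.le (by positivity)).1 (h.trans (min_le_left _ _))
  have h2 := (Real.le_sqrt hδ.le (by positivity)).1 (h.trans (min_le_right _ _))
  rcases le_total 0 x with hx | hx
  · rcases le_total x c with hxc | hxc
    · nlinarith [neg_abs_le (x ^ 2 - c ^ 2)]
    · nlinarith [le_abs_self (x ^ 2 - c ^ 2)]
  · rcases le_total (-x) c with hxc | hxc
    · nlinarith [neg_abs_le (x ^ 2 - c ^ 2)]
    · nlinarith [le_abs_self (x ^ 2 - c ^ 2)]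

set_option maxHeartbeats 2000000 in
theorem hill_variational_estimates_above (α : ℝ) (hα : 2 ≤ α) :
    ∀ δ > (0 : ℝ), ∃ ε > (0 : ℝ), ∃ κ > (0 : ℝ),
      ∀ x y vx vy : ℝ, (x, y) ≠ (0, 0) →
        hillE α x y vx vy < hillEstar α + ε ^ 2 →
        δ ≤ min (Real.sqrt ((x + α ^ ((1 : ℝ) / (α + 2))) ^ 2 + y ^ 2))
            (Real.sqrt ((x - α ^ ((1 : ℝ) / (α + 2))) ^ 2 + y ^ 2)) →
        (hillW α x y ≤ -κ ∧ hillK α x y vx vy ≤ -κ) ∨ κ ≤ hillW α x y := by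
  intro δ hδ
  have hα0 : 0 < α := by linarith
  have hβ : 0 < α + 2 := by linarith
  obtain ⟨c, hcdef⟩ : ∃ c, c = α ^ ((1 : ℝ) / (α + 2)) := ⟨_, rfl⟩
  obtain ⟨s0, hs0def⟩ : ∃ s0, s0 = α ^ (-(α / (α + 2))) := ⟨_, rfl⟩
  have hc : 0 < c := by rw [hcdef]; positivity
  have hs0p : 0 < s0 := by rw [hs0def]; positivity
  have hs0 : s0 * c ^ α = 1 := by
    rw [hs0def, hcdef, ← Real.rpow_mul hα0.le, ← Real.rpow_add hα0]
    have : -(α / (α + 2)) + 1 / (α + 2) * α = 0 := by ring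
    rw [this, Real.rpow_zero]
  have hcs : c ^ 2 = α * s0 := by
    have e : α * s0 = α ^ (1 + -(α / (α + 2))) := by
      rw [Real.rpow_add hα0, Real.rpow_one, hs0def]
    rw [e, hcdef, ← Real.rpow_natCast, ← Real.rpow_mul hα0.le]
    congr 1
    push_cast; field_simp; ring
  have hE : hillEstar α = -(1 / 2) * (α + 2) ^ 2 * s0 := by rw [hs0def]; rfl
  rw [← hcdef, hE]
  obtain ⟨κ, hκdef⟩ : ∃ κ, κ = min ((α + 2) * δ ^ 2 / 8) ((α + 2) ^ 2 * s0 / 4) := ⟨_, rfl⟩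
  have hκ : 0 < κ := by rw [hκdef]; apply lt_min <;> positivity
  have hκ1 : κ ≤ (α + 2) * δ ^ 2 / 8 := by rw [hκdef]; exact min_le_left _ _
  have hκ2 : κ ≤ (α + 2) ^ 2 * s0 / 4 := by rw [hκdef]; exact min_le_right _ _
  obtain ⟨ε, hεdef⟩ : ∃ ε, ε = min 1 (κ / (24 * (1 + c))) := ⟨_, rfl⟩
  have hε : 0 < ε := by rw [hεdef]; apply lt_min <;> positivity
  have hε1 : ε ≤ 1 := by rw [hεdef]; exact min_le_left _ _
  have hε2 : ε * (24 * (1 + c)) ≤ κ := by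
    rw [← le_div_iff₀ (by positivity), hεdef]; exact min_le_right _ _
  have hcε : 0 < c * ε := by positivity
  have hεsq : ε ^ 2 ≤ ε := by
    rw [sq]; exact mul_le_of_le_one_left hε.le hε1
  refine ⟨ε, hε, κ, hκ, ?_⟩
  intro x y vx vy hxy hen hd
  have hdist := hill_dist x y c δ hc hδ hd
  have hpos : 0 < x ^ 2 + y ^ 2 := by
    by_contra hcon
    apply hxy
    have hx : x = 0 := by
      have h1 : x ^ 2 + y ^ 2 ≤ 0 := not_lt.1 hcon
      exact pow_eq_zero_iff (two_ne_zero) |>.1 (by linarith [sq_nonneg x, sq_nonneg y] : x ^ 2 = 0)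
    have hy : y = 0 := by
      have h1 : x ^ 2 + y ^ 2 ≤ 0 := not_lt.1 hcon
      exact pow_eq_zero_iff (two_ne_zero) |>.1 (by linarith [sq_nonneg x, sq_nonneg y] : y ^ 2 = 0)
    rw [hx, hy]
  have hW : hillW α x y = (α + 2) * (x ^ 2 - α / (hillR x y) ^ α) := rfl
  unfold hillE hillV at hen
  unfold hillK
  rw [hW]
  have hr : 0 < hillR x y := Real.sqrt_pos.2 hpos
  have hr2 : (hillR x y) ^ 2 = x ^ 2 + y ^ 2 := Real.sq_sqrt hpos.le
  generalize hillR x y = r at *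
  have hra : 0 < r ^ α := Real.rpow_pos_of_pos hr _
  obtain ⟨s, hsdef⟩ : ∃ s, s = 1 / r ^ α := ⟨_, rfl⟩
  have hs : s * r ^ α = 1 := by rw [hsdef]; field_simp
  have hsp : 0 < s := by rw [hsdef]; positivity
  have e1 : α / r ^ α = α * s := by rw [hsdef]; ring
  have e2 : (α + 2) / r ^ α = (α + 2) * s := by rw [hsdef]; ring
  rw [e2] at hen
  rw [e1]
  rcases lt_or_ge r c with hrc | hrc
  · left
    obtain ⟨hin, hss⟩ := hill_inner α c s0 r s hα hc hs0 hcs hr hrc hs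
    have hrc2 : r ^ 2 < c ^ 2 := pow_lt_pow_left₀ hrc hr.le two_ne_zero
    have hd2 : δ ^ 2 ≤ c ^ 2 - x ^ 2 + y ^ 2 := by
      rw [abs_of_nonpos (by linarith [sq_nonneg y])] at hdist
      linarith
    have hαs : α * s0 ≤ α * s := mul_le_mul_of_nonneg_left hss hα0.le
    have hWb : 2 * (x ^ 2 - α * s) ≤ - δ ^ 2 := by linarith
    have hWβ := mul_le_mul_of_nonneg_left hWb hβ.le
    refine ⟨by linarith, ?_⟩
    obtain ⟨h, hh⟩ : ∃ h, h = (α + 2) ^ 2 * s0 - 2 * (α + 2) * r ^ 2 + (α + 2) * (α - 2) * s := ⟨_, rfl⟩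
    rw [← hh] at hin
    have hhl : 2 * (α + 2) * (c ^ 2 - r ^ 2) ≤ h := by
      rw [hh, hcs]
      have : 0 ≤ (α + 2) * (α - 2) * (s - s0) :=
        mul_nonneg (mul_nonneg hβ.le (by linarith)) (by linarith)
      linarith
    have hh0 : 0 ≤ h := le_trans (mul_nonneg (by positivity) (by linarith)) hhl
    -- cross term
    have hcs1 : (2 * (x * vy - vx * y)) ^ 2 ≤ 4 * r ^ 2 * (vx ^ 2 + vy ^ 2) := by
      rw [hr2]; nlinarith [sq_nonneg (x * vx + y * vy)]
    have hq : vx ^ 2 + vy ^ 2 ≤ -(α + 2) ^ 2 * s0 + (α + 2) * r ^ 2 + 2 * (α + 2) * s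
        - (α + 2) * y ^ 2 + 2 * ε ^ 2 := by rw [hr2]; linarith
    have hβy : 0 ≤ (α + 2) * y ^ 2 := by positivity
    have hq2 := mul_le_mul_of_nonneg_left hq (by positivity : 0 ≤ 4 * r ^ 2)
    have hry : 0 ≤ 4 * r ^ 2 * ((α + 2) * y ^ 2) := by positivity
    have hrε : r ^ 2 * ε ^ 2 ≤ c ^ 2 * ε ^ 2 := mul_le_mul_of_nonneg_right hrc2.le (by positivity)
    have hhc : 0 ≤ h * (c * ε) := mul_nonneg hh0 hcε.le
    have hcross : 2 * (x * vy - vx * y) ≤ h / 2 + 4 * (c * ε) := by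
      apply (abs_le_of_sq_le_sq' _ (by positivity)).2
      have : 0 ≤ c ^ 2 * ε ^ 2 := by positivity
      linarith
    have hK : vx ^ 2 + vy ^ 2 + (α + 2) * (x ^ 2 - α * s) ≤ -h - 2 * ((α + 2) * y ^ 2) + 2 * ε ^ 2 := by
      rw [hh]; have : x ^ 2 = r ^ 2 - y ^ 2 := by linarith
      rw [this]; linarith
    have hdβ := mul_le_mul_of_nonneg_left hd2 hβ.le
    have hfin : -h / 2 - 2 * ((α + 2) * y ^ 2) ≤ - ((α + 2) * δ ^ 2) := by
      rw [hr2] at hhl; linarith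
    linarith
  · right
    by_contra hcon
    push Not at hcon
    have hle : c ^ α ≤ r ^ α := Real.rpow_le_rpow hc.le hrc (by linarith)
    have hca : 0 < c ^ α := Real.rpow_pos_of_pos hc _
    have es0 : s0 = 1 / c ^ α := by field_simp; exact hs0
    have hss : s ≤ s0 := by
      rw [es0, hsdef]; exact one_div_le_one_div_of_le hca hle
    have hv : 0 ≤ vx ^ 2 + vy ^ 2 := by positivity
    -- r² s ≤ c² s0
    have hrs : r ^ 2 * s ≤ c ^ 2 * s0 := by
      have h1 : (r / c) ^ (2 : ℝ) ≤ (r / c) ^ α :=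
        Real.rpow_le_rpow_of_exponent_le ((one_le_div hc).2 hrc) hα
      rw [Real.div_rpow hr.le hc.le, Real.div_rpow hr.le hc.le, Real.rpow_two, Real.rpow_two,
        div_le_div_iff₀ (by positivity) hca] at h1
      have h2 := mul_le_mul_of_nonneg_right h1 (by positivity : 0 ≤ s * s0)
      calc r ^ 2 * s = r ^ 2 * c ^ α * (s * s0) := by
            linear_combination (-(r ^ 2 * s)) * hs0
        _ ≤ r ^ α * c ^ 2 * (s * s0) := h2
        _ = c ^ 2 * s0 := by linear_combination (c ^ 2 * s0) * hs
    obtain ⟨η, hη⟩ : ∃ η, η * (α + 2) ^ 2 = 2 * ε ^ 2 + κ := ⟨(2 * ε ^ 2 + κ) / (α + 2) ^ 2, by field_simp⟩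
    have hβ2 : 0 < (α + 2) ^ 2 := by positivity
    have hη0 : 0 < η := by
      by_contra hneg
      have := mul_nonneg (by linarith : 0 ≤ -η) hβ2.le
      linarith [sq_nonneg ε]
    have hsη : s0 - η < s := by
      by_contra hneg
      push Not at hneg
      have := mul_le_mul_of_nonneg_right hneg hβ2.le
      linarith
    have hηs : η ≤ s0 / 2 := by
      by_contra hneg
      push Not at hneg
      have := mul_lt_mul_of_pos_right hneg hβ2
      linarith
    have hr2u : r ^ 2 ≤ c ^ 2 + 2 * α * η := by
      have h1 : s * r ^ 2 ≤ s * (c ^ 2 + 2 * α * η) := by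
        have h2 : 0 ≤ α * (s - (s0 - η)) * (s0 + 2 * η) :=
          mul_nonneg (mul_nonneg hα0.le (by linarith)) (by linarith)
        have h3 : 0 ≤ α * η * (s0 / 2 - η) := mul_nonneg (by positivity) (by linarith)
        rw [hcs] at hrs ⊢
        nlinarith
      exact le_of_mul_le_mul_left h1 hsp
    have hx2 : (α + 2) * c ^ 2 - 2 * ε ^ 2 < (α + 2) * x ^ 2 := by
      rw [hcs]
      have := mul_le_mul_of_nonneg_left hss hβ.le
      linarith
    have hβη : (α + 2) * (α * η) ≤ 2 * ε ^ 2 + κ := by rw [← hη]; nlinarith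
    have hβr := mul_le_mul_of_nonneg_left hr2u hβ.le
    have hβd := mul_le_mul_of_nonneg_left hdist hβ.le
    have hy0 : 0 ≤ (α + 2) * y ^ 2 := by positivity
    rw [hr2] at hβr
    have habs : (α + 2) * |x ^ 2 - c ^ 2| ≤ 6 * ε ^ 2 + 2 * κ := by
      rcases abs_cases (x ^ 2 - c ^ 2) with ⟨h1, -⟩ | ⟨h1, -⟩ <;> rw [h1] <;> linarith [sq_nonneg ε]
    linarith
end

section
/- Fix a real parameter α > 0. If (x(t), y(t)) is a solution of Hill's lunar equations on its maximal interval of existence [0, T_max) and T_max < ∞, then the solution ends in collision with the origin: (x(t), y(t)) → (0, 0) as t → T_max. -/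
open Real Set Filter Topology ENNReal

lemma hillAux_limit {T C : ℝ} {f f' : ℝ → ℝ}
    (h : ∀ᶠ t in 𝓝[<] T, HasDerivAt f (f' t) t ∧ |f' t| ≤ C) :
    ∃ l, Tendsto f (𝓝[<] T) (𝓝 l) := by
  obtain ⟨a, ha, hs⟩ := (mem_nhdsLT_iff_exists_Ioo_subset).1 h
  have hL : LipschitzOnWith C.toNNReal f (Ioo a T) := by
    refine (convex_Ioo a T).lipschitzOnWith_of_nnnorm_hasDerivWithin_le
      (fun t ht => (hs ht).1.hasDerivWithinAt) (fun t ht => ?_)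
    rw [← NNReal.coe_le_coe, coe_nnnorm, Real.norm_eq_abs]
    exact (hs ht).2.trans (Real.le_coe_toNNReal C)
  obtain ⟨g, hg, hfg⟩ := hL.extend_real
  refine ⟨g T, ?_⟩
  refine ((hg.continuous.tendsto T).mono_left nhdsWithin_le_nhds).congr' ?_
  filter_upwards [Ioo_mem_nhdsLT ha] with t ht using (hfg ht).symm

lemma hillAux_glue {T d : ℝ} {g g' h : ℝ → ℝ}
    (hg : ∀ᶠ t in 𝓝[<] T, HasDerivAt g (g' t) t)
    (hlim : Tendsto g (𝓝[<] T) (𝓝 (h T)))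
    (hlim' : Tendsto g' (𝓝[<] T) (𝓝 d))
    (hh : HasDerivAt h d T) :
    HasDerivAt (fun t => if t < T then g t else h t) d T := by
  set F : ℝ → ℝ := fun t => if t < T then g t else h t with hF
  have hFT : F T = h T := by simp [hF]
  obtain ⟨a, ha, hs⟩ := (mem_nhdsLT_iff_exists_Ioo_subset).1 hg
  have hFg : ∀ t < T, F =ᶠ[𝓝 t] g := fun t ht => by
    filter_upwards [Iio_mem_nhds ht] with u hu
    simp only [hF]; exact if_pos hu
  have hd : ∀ t ∈ Ioo a T, HasDerivAt F (g' t) t := fun t ht =>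
    (hs ht).congr_of_eventuallyEq (hFg t ht.2)
  have hL : HasDerivWithinAt F d (Iic T) T := by
    refine hasDerivWithinAt_Iic_of_tendsto_deriv (s := Ioo a T)
      (fun t ht => (hd t ht).differentiableAt.differentiableWithinAt) ?_ (Ioo_mem_nhdsLT ha) ?_
    · show Tendsto F (𝓝[Ioo a T] T) (𝓝 (F T))
      rw [hFT]
      refine (hlim.mono_left (nhdsWithin_mono _ (fun t ht => ht.2))).congr' ?_
      filter_upwards [self_mem_nhdsWithin] with t ht
      simp only [hF]; exact (if_pos ht.2).symm
    · refine hlim'.congr' ?_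
      filter_upwards [Ioo_mem_nhdsLT ha] with t ht using (hd t ht).deriv.symm
  have hR : HasDerivWithinAt F d (Ici T) T := by
    refine hh.hasDerivWithinAt.congr (fun t ht => ?_) hFT
    simp only [hF]; exact if_neg (not_lt.2 ht)
  have := hL.union hR
  rwa [Iic_union_Ici, hasDerivWithinAt_univ] at this

lemma hillAux_R {x y : ℝ} (γ : ℝ) : hillR x y ^ γ = (x ^ 2 + y ^ 2) ^ (γ / 2) := by
  have : 0 ≤ x ^ 2 + y ^ 2 := by positivity
  rw [hillR, Real.sqrt_eq_rpow, ← Real.rpow_mul this]; congr 1; ring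

lemma hillAux_pos {x y : ℝ} (h : (x, y) ≠ (0, 0)) : 0 < x ^ 2 + y ^ 2 := by
  rcases eq_or_ne x 0 with hx | hx
  · have hy : y ≠ 0 := fun hy => h (by simp [hx, hy])
    positivity
  · positivity

lemma hillAux_energy {α x y vx vy E : ℝ} (hE : hillE α x y vx vy = E) :
    vx ^ 2 + vy ^ 2 = 2 * E + (α + 2) * x ^ 2 + 2 * (α + 2) / (x ^ 2 + y ^ 2) ^ (α / 2) := by
  rw [hillE, hillV, hillAux_R] at hE
  rw [← hE]; ring

lemma hillAux_dE {α t : ℝ} {x y vx vy : ℝ → ℝ} (h0 : (x t, y t) ≠ (0, 0))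
    (hx : HasDerivAt x (vx t) t) (hy : HasDerivAt y (vy t) t)
    (hvx : HasDerivAt vx (2 * vy t - hillVx α (x t) (y t)) t)
    (hvy : HasDerivAt vy (-(2 * vx t) - hillVy α (x t) (y t)) t) :
    HasDerivAt (fun t => hillE α (x t) (y t) (vx t) (vy t)) 0 t := by
  have hp := hillAux_pos h0
  have hs := (hx.fun_pow 2).fun_add (hy.fun_pow 2)
  have hsr := hs.rpow_const (p := -(α / 2)) (Or.inl hp.ne')
  have hmain := ((((hvx.fun_pow 2).fun_add (hvy.fun_pow 2)).const_mul (1 / 2)).fun_add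
    (((hx.fun_pow 2).const_mul (-((α + 2) / 2))).fun_sub (hsr.const_mul (α + 2))))
  have e1 : (fun t => hillE α (x t) (y t) (vx t) (vy t)) = fun t =>
      1 / 2 * (vx t ^ 2 + vy t ^ 2) + (-((α + 2) / 2) * x t ^ 2
        - (α + 2) * (x t ^ 2 + y t ^ 2) ^ (-(α / 2))) := by
    funext u
    rw [hillE, hillV, hillAux_R, Real.rpow_neg (by positivity)]; ring
  rw [e1]
  refine hmain.congr_deriv ?_
  have e2 : (x t ^ 2 + y t ^ 2) ^ (-(α / 2) - 1) = ((x t ^ 2 + y t ^ 2) ^ ((α + 2) / 2))⁻¹ := by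
    rw [← Real.rpow_neg hp.le]; congr 1; ring
  rw [e2, hillVx, hillVy, hillAux_R]
  norm_num
  ring

lemma hillAux_bound {α E x y vx vy : ℝ} (hα : 0 < α) (h0 : 0 < x ^ 2 + y ^ 2)
    (hE : hillE α x y vx vy = E) :
    |((2 * x * vx + 2 * y * vy) * ((α + 2) / 4) * (x ^ 2 + y ^ 2) ^ ((α + 2) / 4 - 1))
      / (1 + (x ^ 2 + y ^ 2) ^ ((α + 2) / 4))|
      ≤ (α + 2) / 2 * Real.sqrt (2 * |E| + 2 * (α + 2)) := by
  have hen := hillAux_energy hE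
  set s := x ^ 2 + y ^ 2 with hs
  set u := s ^ ((α + 2) / 4) with hu
  set w := s ^ ((α + 2) / 4 - 1) with hw
  set z := s ^ (α / 2) with hz
  have hu0 : 0 < u := Real.rpow_pos_of_pos h0 _
  have hw0 : 0 < w := Real.rpow_pos_of_pos h0 _
  have hz0 : 0 < z := Real.rpow_pos_of_pos h0 _
  have hzs : z * s = u ^ 2 := by
    rw [hz, hu, ← Real.rpow_natCast, ← Real.rpow_mul h0.le]
    nth_rewrite 2 [← Real.rpow_one s]
    rw [← Real.rpow_add h0]; congr 1; push_cast; ring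
  have hws : w ^ 2 * s = z := by
    rw [hz, hw, ← Real.rpow_natCast, ← Real.rpow_mul h0.le]
    nth_rewrite 2 [← Real.rpow_one s]
    rw [← Real.rpow_add h0]; congr 1; push_cast; ring
  have hz1 : z ≤ 1 + u ^ 2 := by
    rcases le_total s 1 with h | h
    · have : z ≤ 1 := Real.rpow_le_one h0.le h (by positivity)
      nlinarith [sq_nonneg u]
    · nlinarith
  have hkey : (w * (x * vx + y * vy)) ^ 2 ≤ (2 * |E| + 2 * (α + 2)) * (1 + u) ^ 2 := by
    have h1 : (x * vx + y * vy) ^ 2 ≤ s * (vx ^ 2 + vy ^ 2) := by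
      rw [hs]; nlinarith [sq_nonneg (x * vy - y * vx)]
    have h2 : (w * (x * vx + y * vy)) ^ 2 ≤ z * (vx ^ 2 + vy ^ 2) := by
      calc _ = w ^ 2 * (x * vx + y * vy) ^ 2 := by ring
        _ ≤ w ^ 2 * (s * (vx ^ 2 + vy ^ 2)) := by gcongr
        _ = _ := by rw [← hws]; ring
    have h3 : z * (vx ^ 2 + vy ^ 2) = 2 * E * z + (α + 2) * (z * x ^ 2) + 2 * (α + 2) := by
      rw [hen]; field_simp
    have h4 : z * x ^ 2 ≤ u ^ 2 := by
      rw [← hzs]; gcongr; rw [hs]; nlinarith [sq_nonneg y]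
    have h5 : 2 * E * z ≤ 2 * |E| * (1 + u ^ 2) := by
      have := le_abs_self E
      have := abs_nonneg E
      calc 2 * E * z ≤ 2 * |E| * z := by gcongr
        _ ≤ _ := by gcongr
    have h6 : (α + 2) * (z * x ^ 2) ≤ (α + 2) * u ^ 2 := by gcongr
    have h7 : 0 ≤ |E| * u := by positivity
    have h8 : 0 ≤ α * u := by positivity
    have h9 : 0 ≤ α * u ^ 2 := by positivity
    nlinarith [sq_nonneg u]
  have hk2 : |w * (x * vx + y * vy)| ≤ Real.sqrt (2 * |E| + 2 * (α + 2)) * (1 + u) := by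
    have hnn : 0 ≤ 2 * |E| + 2 * (α + 2) := by positivity
    apply abs_le_of_sq_le_sq _ (by positivity)
    rw [mul_pow (√_), Real.sq_sqrt hnn]; exact hkey
  rw [abs_div, abs_of_pos (show 0 < 1 + u by positivity), div_le_iff₀ (by positivity)]
  have : (2 * x * vx + 2 * y * vy) * ((α + 2) / 4) * w
      = (α + 2) / 2 * (w * (x * vx + y * vy)) := by ring
  rw [this, abs_mul, abs_of_pos (show 0 < (α + 2) / 2 by positivity), mul_assoc]
  gcongr

lemma hillAux_contVx {α : ℝ} {p : ℝ × ℝ × ℝ × ℝ} (h : 0 < p.1 ^ 2 + p.2.1 ^ 2) :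
    ContDiffAt ℝ 1 (fun p : ℝ × ℝ × ℝ × ℝ => hillVx α p.1 p.2.1) p := by
  simp only [hillVx, hillAux_R]
  have h' := (Real.rpow_pos_of_pos h ((α + 2) / 2)).ne'
  have hs : ContDiffAt ℝ 1 (fun p : ℝ × ℝ × ℝ × ℝ => p.1 ^ 2 + p.2.1 ^ 2) p := by fun_prop
  have hr := hs.rpow_const_of_ne (p := (α + 2) / 2) h.ne'
  exact ContDiffAt.add (by fun_prop) (ContDiffAt.div (by fun_prop) hr h')

lemma hillAux_contVy {α : ℝ} {p : ℝ × ℝ × ℝ × ℝ} (h : 0 < p.1 ^ 2 + p.2.1 ^ 2) :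
    ContDiffAt ℝ 1 (fun p : ℝ × ℝ × ℝ × ℝ => hillVy α p.1 p.2.1) p := by
  simp only [hillVy, hillAux_R]
  have h' := (Real.rpow_pos_of_pos h ((α + 2) / 2)).ne'
  have hs : ContDiffAt ℝ 1 (fun p : ℝ × ℝ × ℝ × ℝ => p.1 ^ 2 + p.2.1 ^ 2) p := by fun_prop
  have hr := hs.rpow_const_of_ne (p := (α + 2) / 2) h.ne'
  exact (ContDiffAt.div (by fun_prop) hr h')

lemma hillAux_tend {α T a b : ℝ} {x y : ℝ → ℝ} (h : 0 < a ^ 2 + b ^ 2)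
    (hx : Tendsto x (𝓝[<] T) (𝓝 a)) (hy : Tendsto y (𝓝[<] T) (𝓝 b)) :
    Tendsto (fun t => hillVx α (x t) (y t)) (𝓝[<] T) (𝓝 (hillVx α a b)) ∧
    Tendsto (fun t => hillVy α (x t) (y t)) (𝓝[<] T) (𝓝 (hillVy α a b)) := by
  have hz : Tendsto (fun _ : ℝ => (0 : ℝ)) (𝓝[<] T) (𝓝 0) := tendsto_const_nhds
  have hp : Tendsto (fun t => (x t, y t, (0 : ℝ), (0 : ℝ))) (𝓝[<] T) (𝓝 (a, b, 0, 0)) :=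
    hx.prodMk_nhds (hy.prodMk_nhds (hz.prodMk_nhds hz))
  exact ⟨((hillAux_contVx (α := α) (p := (a, b, 0, 0)) h).continuousAt.tendsto).comp hp,
    ((hillAux_contVy (α := α) (p := (a, b, 0, 0)) h).continuousAt.tendsto).comp hp⟩

lemma hillAux_local (α T a b c d : ℝ) (h : 0 < a ^ 2 + b ^ 2) :
    ∃ X Y U V : ℝ → ℝ, X T = a ∧ Y T = b ∧ U T = c ∧ V T = d ∧ ∃ ε > 0,
      ∀ t ∈ Ioo (T - ε) (T + ε), (X t, Y t) ≠ (0, 0) ∧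
        HasDerivAt X (U t) t ∧ HasDerivAt Y (V t) t ∧
        HasDerivAt U (2 * V t - hillVx α (X t) (Y t)) t ∧
        HasDerivAt V (-(2 * U t) - hillVy α (X t) (Y t)) t := by
  have hF : ContDiffAt ℝ 1 (fun p : ℝ × ℝ × ℝ × ℝ =>
      ((p.2.2.1, p.2.2.2, 2 * p.2.2.2 - hillVx α p.1 p.2.1,
        -(2 * p.2.2.1) - hillVy α p.1 p.2.1) : ℝ × ℝ × ℝ × ℝ)) (a, b, c, d) := by
    have h1 := hillAux_contVx (α := α) (p := (a, b, c, d)) h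
    have h2 := hillAux_contVy (α := α) (p := (a, b, c, d)) h
    exact ContDiffAt.prodMk (by fun_prop) (ContDiffAt.prodMk (by fun_prop)
      (ContDiffAt.prodMk (ContDiffAt.sub (by fun_prop) h1) (ContDiffAt.sub (by fun_prop) h2)))
  obtain ⟨f, hf0, ε, hε, hf⟩ :=
    hF.exists_forall_mem_closedBall_exists_eq_forall_mem_Ioo_hasDerivAt₀ T
  have hfc : ContinuousAt f T := (hf T ⟨by linarith, by linarith⟩).continuousAt
  have hev : ∀ᶠ t in 𝓝 T, 0 < (f t).1 ^ 2 + (f t).2.1 ^ 2 := by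
    have : ContinuousAt (fun t => (f t).1 ^ 2 + (f t).2.1 ^ 2) T := by fun_prop
    refine this.eventually_const_lt ?_
    simp only [hf0]; exact h
  obtain ⟨δ, hδ, hball⟩ := Metric.eventually_nhds_iff_ball.1 hev
  refine ⟨fun t => (f t).1, fun t => (f t).2.1, fun t => (f t).2.2.1, fun t => (f t).2.2.2,
    by simp [hf0], by simp [hf0], by simp [hf0], by simp [hf0], min ε δ, lt_min hε hδ, ?_⟩
  intro t ht
  have hle := min_le_left ε δ
  have hle' := min_le_right ε δ
  have hd := hf t ⟨by linarith [ht.1], by linarith [ht.2]⟩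
  have hb := hball t (by
    rw [Real.ball_eq_Ioo]; exact ⟨by linarith [ht.1], by linarith [ht.2]⟩)
  rw [hasDerivAt_iff_hasFDerivAt] at hd
  have h1 := hd.fst.hasDerivAt
  have h2 := hd.snd.fst.hasDerivAt
  have h3 := hd.snd.snd.fst.hasDerivAt
  have h4 := hd.snd.snd.snd.hasDerivAt
  refine ⟨?_, ?_, ?_, ?_, ?_⟩
  · intro hc
    simp only [Prod.mk.injEq] at hc
    rw [hc.1, hc.2] at hb; norm_num at hb
  · simpa using h1
  · simpa using h2
  · simpa using h3
  · simpa using h4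

lemma hillAux_extend {α T a b c d : ℝ} (hT : 0 < T) {x y : ℝ → ℝ}
    (hs : HillSolOn α x y (ENNReal.ofReal T)) (h : 0 < a ^ 2 + b ^ 2)
    (hx : Tendsto x (𝓝[<] T) (𝓝 a)) (hy : Tendsto y (𝓝[<] T) (𝓝 b))
    (hvx : Tendsto (deriv x) (𝓝[<] T) (𝓝 c)) (hvy : Tendsto (deriv y) (𝓝[<] T) (𝓝 d)) :
    ∃ ε > 0, ∃ x₂ y₂ : ℝ → ℝ, HillSolOn α x₂ y₂ (ENNReal.ofReal (T + ε)) ∧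
      ∀ t < T, x₂ t = x t ∧ y₂ t = y t := by
  obtain ⟨X, Y, U, V, hX, hY, hU, hV, ε, hε, hl⟩ := hillAux_local α T a b c d h
  obtain ⟨hVx, hVy⟩ := hillAux_tend (α := α) h hx hy
  have hdom : ∀ t, 0 ≤ t → t < T → t ∈ hillDomain (ENNReal.ofReal T) := fun t h0 h1 =>
    ⟨h0, (ENNReal.ofReal_lt_ofReal_iff hT).2 h1⟩
  have hev : ∀ᶠ t in 𝓝[<] T, t ∈ hillDomain (ENNReal.ofReal T) := by
    filter_upwards [Ioo_mem_nhdsLT hT] with t ht using hdom t ht.1.le ht.2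
  have hlT := hl T ⟨by linarith, by linarith⟩
  rw [hX, hY, hU, hV] at hlT
  obtain ⟨-, gX, gY, gU, gV⟩ := hlT
  have kx := hillAux_glue (g := x) (g' := deriv x) (h := X) (d := c)
    (hev.mono fun t ht => (hs t ht).2.1) (by rw [hX]; exact hx) hvx gX
  have ky := hillAux_glue (g := y) (g' := deriv y) (h := Y) (d := d)
    (hev.mono fun t ht => (hs t ht).2.2.1) (by rw [hY]; exact hy) hvy gY
  have ku := hillAux_glue (g := deriv x) (h := U)
    (hev.mono fun t ht => (hs t ht).2.2.2.1) (by rw [hU]; exact hvx)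
    ((hvy.const_mul 2).sub hVx) gU
  have kv := hillAux_glue (g := deriv y) (h := V)
    (hev.mono fun t ht => (hs t ht).2.2.2.2) (by rw [hV]; exact hvy)
    ((hvx.const_mul 2).neg.sub hVy) gV
  have eL : ∀ (g k : ℝ → ℝ) (t : ℝ), t < T →
      (fun t => if t < T then g t else k t) =ᶠ[𝓝 t] g := fun g k t ht => by
    filter_upwards [Iio_mem_nhds ht] with u hu using if_pos hu
  have eR : ∀ (g k : ℝ → ℝ) (t : ℝ), T < t →
      (fun t => if t < T then g t else k t) =ᶠ[𝓝 t] k := fun g k t ht => by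
    filter_upwards [Ioi_mem_nhds ht] with u hu using if_neg (not_lt.2 (le_of_lt hu))
  set x₂ : ℝ → ℝ := fun t => if t < T then x t else X t with hx₂
  set y₂ : ℝ → ℝ := fun t => if t < T then y t else Y t with hy₂
  set u₂ : ℝ → ℝ := fun t => if t < T then deriv x t else U t with hu₂
  set v₂ : ℝ → ℝ := fun t => if t < T then deriv y t else V t with hv₂
  have dx : ∀ t < T + ε, deriv x₂ t = u₂ t := by
    intro t ht
    rcases lt_trichotomy t T with h1 | h1 | h1
    · rw [(eL x X t h1).deriv_eq]; simp [hu₂, h1]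
    · subst h1; rw [kx.deriv]; simp [hu₂, hU]
    · rw [(eR x X t h1).deriv_eq, (hl t ⟨by linarith, ht⟩).2.1.deriv]; simp [hu₂, h1.le]
  have dy : ∀ t < T + ε, deriv y₂ t = v₂ t := by
    intro t ht
    rcases lt_trichotomy t T with h1 | h1 | h1
    · rw [(eL y Y t h1).deriv_eq]; simp [hv₂, h1]
    · subst h1; rw [ky.deriv]; simp [hv₂, hV]
    · rw [(eR y Y t h1).deriv_eq, (hl t ⟨by linarith, ht⟩).2.2.1.deriv]; simp [hv₂, h1.le]
  refine ⟨ε, hε, x₂, y₂, ?_, fun t ht => ⟨by simp [hx₂, ht], by simp [hy₂, ht]⟩⟩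
  rintro t ⟨ht0, ht1⟩
  rw [ENNReal.ofReal_lt_ofReal_iff (by linarith)] at ht1
  have edx : deriv x₂ =ᶠ[𝓝 t] u₂ := by
    filter_upwards [Iio_mem_nhds ht1] with w hw using dx w hw
  have edy : deriv y₂ =ᶠ[𝓝 t] v₂ := by
    filter_upwards [Iio_mem_nhds ht1] with w hw using dy w hw
  rw [dx t ht1, dy t ht1]
  suffices hh : (x₂ t, y₂ t) ≠ (0, 0) ∧ HasDerivAt x₂ (u₂ t) t ∧ HasDerivAt y₂ (v₂ t) t ∧
      HasDerivAt u₂ (2 * v₂ t - hillVx α (x₂ t) (y₂ t)) t ∧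
      HasDerivAt v₂ (-(2 * u₂ t) - hillVy α (x₂ t) (y₂ t)) t by
    obtain ⟨h1, h2, h3, h4, h5⟩ := hh
    exact ⟨h1, h2, h3, h4.congr_of_eventuallyEq edx, h5.congr_of_eventuallyEq edy⟩
  rcases lt_trichotomy t T with h1 | h1 | h1
  · obtain ⟨q1, q2, q3, q4, q5⟩ := hs t (hdom t ht0 h1)
    rw [show x₂ t = x t by simp [hx₂, h1], show y₂ t = y t by simp [hy₂, h1],
      show u₂ t = deriv x t by simp [hu₂, h1], show v₂ t = deriv y t by simp [hv₂, h1]]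
    exact ⟨q1, q2.congr_of_eventuallyEq (eL _ _ t h1), q3.congr_of_eventuallyEq (eL _ _ t h1),
      q4.congr_of_eventuallyEq (eL _ _ t h1), q5.congr_of_eventuallyEq (eL _ _ t h1)⟩
  · subst h1
    rw [show x₂ t = a by simp [hx₂, hX], show y₂ t = b by simp [hy₂, hY],
      show u₂ t = c by simp [hu₂, hU], show v₂ t = d by simp [hv₂, hV]]
    refine ⟨?_, kx, ky, ku, kv⟩
    intro hc
    simp only [Prod.mk.injEq] at hc
    rw [hc.1, hc.2] at h; norm_num at h
  · obtain ⟨q1, q2, q3, q4, q5⟩ := hl t ⟨by linarith, ht1⟩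
    have h1' := not_lt.2 h1.le
    rw [show x₂ t = X t by simp [hx₂, h1'], show y₂ t = Y t by simp [hy₂, h1'],
      show u₂ t = U t by simp [hu₂, h1'], show v₂ t = V t by simp [hv₂, h1']]
    exact ⟨q1, q2.congr_of_eventuallyEq (eR _ _ t h1), q3.congr_of_eventuallyEq (eR _ _ t h1),
      q4.congr_of_eventuallyEq (eR _ _ t h1), q5.congr_of_eventuallyEq (eR _ _ t h1)⟩

lemma hillAux_limS {α T : ℝ} (hα : 0 < α) {x y : ℝ → ℝ} {E : ℝ}
    (hs : ∀ᶠ t in 𝓝[<] T, (x t, y t) ≠ (0, 0) ∧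
      HasDerivAt x (deriv x t) t ∧ HasDerivAt y (deriv y t) t ∧
      hillE α (x t) (y t) (deriv x t) (deriv y t) = E) :
    ∃ σ : ℝ, 0 ≤ σ ∧ Tendsto (fun t => x t ^ 2 + y t ^ 2) (𝓝[<] T) (𝓝 σ) := by
  set β := (α + 2) / 4 with hβ
  have hβ0 : 0 < β := by positivity
  obtain ⟨l, hl⟩ := hillAux_limit (T := T)
    (C := (α + 2) / 2 * Real.sqrt (2 * |E| + 2 * (α + 2)))
    (f := fun t => Real.log (1 + (x t ^ 2 + y t ^ 2) ^ β))
    (f' := fun t => ((2 * x t * deriv x t + 2 * y t * deriv y t) * ((α + 2) / 4) *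
      (x t ^ 2 + y t ^ 2) ^ ((α + 2) / 4 - 1)) / (1 + (x t ^ 2 + y t ^ 2) ^ ((α + 2) / 4))) (by
      filter_upwards [hs] with t ht
      obtain ⟨h0, h1, h2, h3⟩ := ht
      have hp := hillAux_pos h0
      refine ⟨?_, hillAux_bound hα hp h3⟩
      have hu : 0 < (x t ^ 2 + y t ^ 2) ^ β := Real.rpow_pos_of_pos hp _
      have := ((((h1.fun_pow 2).fun_add (h2.fun_pow 2)).rpow_const (p := β)
        (Or.inl hp.ne')).const_add 1).log (by positivity)
      refine this.congr_deriv ?_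
      norm_num [hβ])
  have h1 : Tendsto (fun t => (x t ^ 2 + y t ^ 2) ^ β) (𝓝[<] T) (𝓝 (Real.exp l - 1)) := by
    refine ((Real.continuous_exp.tendsto l).comp hl |>.sub_const 1).congr fun t => ?_
    have : 0 ≤ (x t ^ 2 + y t ^ 2) ^ β := by positivity
    simp only [Function.comp]
    rw [Real.exp_log (by positivity)]; ring
  have h2 : Tendsto (fun t => x t ^ 2 + y t ^ 2) (𝓝[<] T) (𝓝 ((Real.exp l - 1) ^ β⁻¹)) := by
    refine (h1.rpow_const (p := β⁻¹) (Or.inr (by positivity))).congr fun t => ?_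
    rw [← Real.rpow_mul (by positivity), mul_inv_cancel₀ hβ0.ne', Real.rpow_one]
  exact ⟨_, ge_of_tendsto' h2 (fun t => by positivity), h2⟩

lemma hillAux_main {α T : ℝ} (hα : 0 < α) (hT : 0 < T) {x y : ℝ → ℝ}
    (hs : HillSolOn α x y (ENNReal.ofReal T))
    (hmax : ¬ ∃ ε > 0, ∃ x₂ y₂ : ℝ → ℝ, HillSolOn α x₂ y₂ (ENNReal.ofReal (T + ε)) ∧
      ∀ t < T, x₂ t = x t ∧ y₂ t = y t) :
    Tendsto (fun t => (x t, y t)) (𝓝[<] T) (𝓝 ((0 : ℝ), (0 : ℝ))) := by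
  have hdom : ∀ t ∈ Ico 0 T, t ∈ hillDomain (ENNReal.ofReal T) := fun t ht =>
    ⟨ht.1, (ENNReal.ofReal_lt_ofReal_iff hT).2 ht.2⟩
  have hev : ∀ᶠ t in 𝓝[<] T, t ∈ Ico 0 T := by
    filter_upwards [Ioo_mem_nhdsLT hT] with t ht using ⟨ht.1.le, ht.2⟩
  set E := hillE α (x 0) (y 0) (deriv x 0) (deriv y 0) with hEdef
  have hE : ∀ t ∈ Ico 0 T, hillE α (x t) (y t) (deriv x t) (deriv y t) = E := by
    intro t ht
    have := (convex_Ico 0 T).norm_image_sub_le_of_norm_hasDerivWithin_le (C := 0)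
      (f := fun t => hillE α (x t) (y t) (deriv x t) (deriv y t)) (f' := fun _ => 0)
      (fun u hu => by
        obtain ⟨q1, q2, q3, q4, q5⟩ := hs u (hdom u hu)
        exact (hillAux_dE q1 q2 q3 q4 q5).hasDerivWithinAt) (fun u hu => by simp)
      (show (0 : ℝ) ∈ Ico 0 T from ⟨le_rfl, hT⟩) ht
    rw [zero_mul] at this
    exact sub_eq_zero.1 (norm_le_zero_iff.1 this)
  obtain ⟨σ, hσ0, hσ⟩ := hillAux_limS (T := T) (x := x) (y := y) (E := E) hα (by
    filter_upwards [hev] with t ht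
    obtain ⟨q1, q2, q3, q4, q5⟩ := hs t (hdom t ht)
    exact ⟨q1, q2, q3, hE t ht⟩)
  rcases hσ0.eq_or_lt with h0 | h0
  · rw [← h0] at hσ
    have hsq : Tendsto (fun t => √(x t ^ 2 + y t ^ 2)) (𝓝[<] T) (𝓝 0) := by
      simpa using hσ.sqrt
    have hx : Tendsto x (𝓝[<] T) (𝓝 0) := by
      refine squeeze_zero_norm (fun t => ?_) hsq
      exact Real.abs_le_sqrt (by nlinarith [sq_nonneg (y t)])
    have hy : Tendsto y (𝓝[<] T) (𝓝 0) := by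
      refine squeeze_zero_norm (fun t => ?_) hsq
      exact Real.abs_le_sqrt (by nlinarith [sq_nonneg (x t)])
    exact hx.prodMk_nhds hy
  · exfalso
    apply hmax
    have hB : Tendsto (fun t => 2 * E + (α + 2) * (x t ^ 2 + y t ^ 2)
        + 2 * (α + 2) / (x t ^ 2 + y t ^ 2) ^ (α / 2)) (𝓝[<] T)
        (𝓝 (2 * E + (α + 2) * σ + 2 * (α + 2) / σ ^ (α / 2))) :=
      ((hσ.const_mul _).const_add _).add
        (tendsto_const_nhds.div (hσ.rpow_const (Or.inl h0.ne'))
          (Real.rpow_pos_of_pos h0 _).ne')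
    set M := 2 * E + (α + 2) * σ + 2 * (α + 2) / σ ^ (α / 2) + 1 with hM
    have hv : ∀ᶠ t in 𝓝[<] T, deriv x t ^ 2 + deriv y t ^ 2 ≤ M := by
      filter_upwards [hev, hB.eventually_le_const (show _ < M by rw [hM]; linarith)] with t ht hb
      rw [hillAux_energy (hE t ht)]
      nlinarith [sq_nonneg (y t)]
    have hvx : ∀ᶠ t in 𝓝[<] T, |deriv x t| ≤ √M := hv.mono fun t ht =>
      Real.abs_le_sqrt (by nlinarith [sq_nonneg (deriv y t)])
    have hvy : ∀ᶠ t in 𝓝[<] T, |deriv y t| ≤ √M := hv.mono fun t ht =>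
      Real.abs_le_sqrt (by nlinarith [sq_nonneg (deriv x t)])
    obtain ⟨a, ha⟩ := hillAux_limit (f := x) (f' := deriv x) (T := T) (C := √M) (by
      filter_upwards [hev, hvx] with t ht h using ⟨(hs t (hdom t ht)).2.1, h⟩)
    obtain ⟨b, hb⟩ := hillAux_limit (f := y) (f' := deriv y) (T := T) (C := √M) (by
      filter_upwards [hev, hvy] with t ht h using ⟨(hs t (hdom t ht)).2.2.1, h⟩)
    have hab : 0 < a ^ 2 + b ^ 2 := by
      rw [tendsto_nhds_unique ((ha.pow 2).add (hb.pow 2)) hσ]; exact h0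
    obtain ⟨hVx, hVy⟩ := hillAux_tend (α := α) hab ha hb
    obtain ⟨c, hc⟩ := hillAux_limit (f := deriv x) (T := T)
      (f' := fun t => 2 * deriv y t - hillVx α (x t) (y t))
      (C := 2 * √M + (|hillVx α a b| + 1)) (by
      filter_upwards [hev, hvy, hVx.abs.eventually_le_const (lt_add_one _)] with t ht h h'
      refine ⟨(hs t (hdom t ht)).2.2.2.1, (abs_sub _ _).trans ?_⟩
      rw [abs_mul, abs_two]; linarith)
    obtain ⟨d, hd⟩ := hillAux_limit (f := deriv y) (T := T)
      (f' := fun t => -(2 * deriv x t) - hillVy α (x t) (y t))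
      (C := 2 * √M + (|hillVy α a b| + 1)) (by
      filter_upwards [hev, hvx, hVy.abs.eventually_le_const (lt_add_one _)] with t ht h h'
      refine ⟨(hs t (hdom t ht)).2.2.2.2, (abs_sub _ _).trans ?_⟩
      rw [abs_neg, abs_mul, abs_two]; linarith)
    exact hillAux_extend hT hs hab ha hb hc hd

/-- if the maximal time of existence of a solution of Hill's lunar
equations is finite, then the solution ends in collision with the origin. -/
theorem hill_finite_time_singularity_is_collision
    (α : ℝ) (hα : 0 < α) (Tmax : ℝ≥0∞) (hT : 0 < Tmax) (hTfin : Tmax ≠ ⊤)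
    (x y : ℝ → ℝ) (hsol : HillMaxSol α x y Tmax) :
    Tendsto (fun t => (x t, y t)) (𝓝[<] Tmax.toReal) (𝓝 ((0 : ℝ), (0 : ℝ))) := by
  have hT0 : 0 < Tmax.toReal := ENNReal.toReal_pos hT.ne' hTfin
  have hTT : ENNReal.ofReal Tmax.toReal = Tmax := ENNReal.ofReal_toReal hTfin
  obtain ⟨hs, hmax⟩ := hsol
  refine hillAux_main hα hT0 (by rw [hTT]; exact hs) ?_
  rintro ⟨ε, hε, x₂, y₂, h2, heq⟩
  refine hmax (ENNReal.ofReal (Tmax.toReal + ε)) ?_ ⟨x₂, y₂, h2, ?_⟩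
  · conv_lhs => rw [← hTT]
    exact (ENNReal.ofReal_lt_ofReal_iff (by linarith)).2 (by linarith)
  · rintro t ⟨-, ht⟩
    refine heq t ?_
    rw [← hTT] at ht
    exact (ENNReal.ofReal_lt_ofReal_iff hT0).1 ht
end
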